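/- arXiv:math/0505156 — 2 statements merged into one kernel-verified Lean document; each statement's English description precedes it below -/
import Mathlib

section
/- Let Q_n be a random symmetric n×n matrix whose upper-diagonal entries q_{ij} (1 ≤ i ≤ j ≤ n) are i.i.d. Bernoulli random variables taking values 0 and 1 each with probability 1/2. Then for any fixed constant δ > 0, the probability that Q_n is singular is O(n^{-1/8+δ}) as n → ∞; that is, there is a constant C (depending on δ) such that P(det Q_n = 0) ≤ C n^{-1/8+δ} for all n ≥ 1. In particular, Q_n is nonsingular with probability tending to 1 as n → ∞. -/
open scoped Classical

/-- The set of upper-diagonal index pairs `(i, j)` with `i ≤ j` of an `n × n` matrix. -/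
abbrev UpIdx (n : ℕ) := {p : Fin n × Fin n // p.1 ≤ p.2}

/-- The random symmetric Bernoulli matrix determined by an assignment `ω` of `{0,1}` values
(`Bool`) to the upper-diagonal entries: entry `(i,j)` is `1` if `ω` is `true` at the upper
index `(min i j, max i j)` and `0` otherwise. -/
noncomputable def bmat (n : ℕ) (ω : UpIdx n → Bool) : Matrix (Fin n) (Fin n) ℝ :=
  Matrix.of fun i j => if ω ⟨(min i j, max i j), min_le_max⟩ then 1 else 0

/-- The probability of an event under the uniform measure on a finite type;
for i.i.d. Bernoulli(1/2) upper-diagonal entries this is exactly the distribution of `bmat`. -/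
noncomputable def unifProb {α : Type*} [Fintype α] (P : α → Prop) : ℝ :=
  ((Finset.univ.filter P).card : ℝ) / (Fintype.card α : ℝ)


noncomputable def bv (b : Bool) : ℝ := if b then 1 else 0

lemma centralBinom_sq (n : ℕ) : (n.centralBinom)^2 * (2*n+1) ≤ 16^n := by
  induction n with
  | zero => simp
  | succ n ih =>
    have h := Nat.succ_mul_centralBinom_succ n
    have h2 : (n+1)^2 * ((n+1).centralBinom^2 * (2*(n+1)+1)) ≤ (n+1)^2 * 16^(n+1) := by
      calc (n+1)^2 * ((n+1).centralBinom^2 * (2*(n+1)+1))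
          = ((n+1)*(n+1).centralBinom)^2 * (2*n+3) := by ring
        _ = (n.centralBinom^2 * (2*n+1)) * (4*(2*n+1)*(2*n+3)) := by rw [h]; ring
        _ ≤ 16^n * (4*(2*n+1)*(2*n+3)) := Nat.mul_le_mul_right _ ih
        _ ≤ 16^n * (16 * (n+1)^2) := Nat.mul_le_mul_left _ (by nlinarith)
        _ = _ := by ring
    exact Nat.le_of_mul_le_mul_left h2 (by positivity)

lemma choose_half_sq (s : ℕ) : (s.choose (s/2))^2 * s ≤ 4^s := by
  rcases Nat.even_or_odd' s with ⟨n, rfl | rfl⟩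
  · have h := centralBinom_sq n
    rw [Nat.centralBinom] at h
    rw [show 2*n/2 = n by omega, pow_mul]
    norm_num
    nlinarith [sq_nonneg ((2*n).choose n)]
  · have h := centralBinom_sq (n+1)
    have h2 : (n+1).centralBinom = 2 * (2*n+1).choose n := by
      rw [Nat.centralBinom, show 2*(n+1) = (2*n+1)+1 by ring, Nat.choose_succ_succ,
        Nat.choose_symm_half]; ring
    rw [h2] at h
    rw [show (2*n+1)/2 = n by omega]
    have : (4:ℕ)^(2*n+1) * 4 = 16^(n+1) := by
      rw [show (16:ℕ) = 4^2 by norm_num, ← pow_mul]; ring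
    nlinarith [sq_nonneg ((2*n+1).choose n)]

lemma choose_half_le (s : ℕ) (r : ℝ) (hr : 0 < r) (h : r ≤ s) :
    (s.choose (s/2) : ℝ) ≤ 2^s / √r := by
  rw [le_div_iff₀ (Real.sqrt_pos.2 hr)]
  refine (pow_le_pow_iff_left₀ (by positivity) (by positivity) two_ne_zero).1 ?_
  rw [mul_pow, Real.sq_sqrt hr.le, ← pow_mul, mul_comm s 2, pow_mul]
  have := choose_half_sq s
  have h3 : ((s.choose (s/2))^2 * s : ℝ) ≤ 4^s := by exact_mod_cast this
  norm_num
  nlinarith [sq_nonneg ((s.choose (s/2)) : ℝ)]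

lemma LO0 {ι : Type*} [Fintype ι] (a : ι → ℝ) (c : ℝ) (h : ∀ i, a i ≠ 0) :
    (Finset.univ.filter (fun y : ι → Bool => ∑ i, a i * bv (y i) = c)).card
      ≤ (Fintype.card ι).choose (Fintype.card ι / 2) := by
  let F : (ι → Bool) → Finset ι := fun y => Finset.univ.filter (fun i => xor (y i) (decide (a i < 0)) = true)
  have hF : Function.Injective F := by
    intro y z hyz
    funext i
    have := congrArg (fun s => i ∈ s) hyz
    simp only [F, Finset.mem_filter, Finset.mem_univ, true_and, eq_iff_iff] at this
    revert this
    cases y i <;> cases z i <;> cases decide (a i < 0) <;> simp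
  rw [← Finset.card_image_of_injective _ hF]
  apply IsAntichain.sperner
  intro s hs t ht hne hle
  simp only [Finset.coe_image, Finset.coe_filter, Finset.mem_univ, true_and, Set.mem_image,
    Set.mem_ofPred_eq] at hs ht
  obtain ⟨y, hy, rfl⟩ := hs
  obtain ⟨z, hz, rfl⟩ := ht
  have key : ∀ i, a i * bv (y i) ≤ a i * bv (z i) ∧ (y i ≠ z i → a i * bv (y i) < a i * bv (z i)) := by
    intro i
    have h1 : i ∈ F y → i ∈ F z := fun q => hle q
    simp only [F, Finset.mem_filter, Finset.mem_univ, true_and] at h1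
    rcases lt_or_gt_of_ne (h i) with h2 | h2
    · revert h1
      cases y i <;> cases z i <;> simp [bv, h2, h2.le]
    · revert h1
      cases y i <;> cases z i <;> simp [bv, h2, h2.le, not_lt.2 h2.le]
  have hyz : ∃ i, y i ≠ z i := by
    by_contra! hh
    exact hne (congrArg F (funext hh))
  obtain ⟨i, hi⟩ := hyz
  have : ∑ i, a i * bv (y i) < ∑ i, a i * bv (z i) :=
    Finset.sum_lt_sum (fun i _ => (key i).1) ⟨i, Finset.mem_univ _, (key i).2 hi⟩
  rw [hy, hz] at this
  exact lt_irrefl _ this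

lemma card_filter_prod {α β : Type*} [Fintype α] [Fintype β] (P : α × β → Prop) :
    (Finset.univ.filter P).card = ∑ b, (Finset.univ.filter (fun a => P (a, b))).card := by
  simp only [Finset.card_filter]
  rw [Fintype.sum_prod_type_right]

lemma card_filter_equiv {α β : Type*} [Fintype α] [Fintype β] (e : α ≃ β) (P : α → Prop) :
    (Finset.univ.filter P).card = (Finset.univ.filter (fun b => P (e.symm b))).card := by
  simp only [Finset.card_filter]
  exact Fintype.sum_equiv e _ _ (fun x => by simp)

lemma LO {ι : Type*} [Fintype ι] (a : ι → ℝ) (c r : ℝ) (hr : 0 < r)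
    (h : r ≤ (Finset.univ.filter (fun i => a i ≠ 0)).card) :
    ((Finset.univ.filter (fun y : ι → Bool => ∑ i, a i * bv (y i) = c)).card : ℝ)
      ≤ 2 ^ (Fintype.card ι) / √r := by
  let p : ι → Prop := fun i => a i ≠ 0
  let e := Equiv.piEquivPiSubtypeProd p (fun _ => Bool)
  rw [card_filter_equiv e, card_filter_prod]
  have hs : r ≤ Fintype.card {i // p i} := by rw [Fintype.card_subtype]; exact h
  have key : ∀ z : ({i // ¬ p i} → Bool),
      ((Finset.univ.filter (fun y : {i // p i} → Bool => ∑ i, a i * bv (e.symm (y, z) i) = c)).card : ℝ)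
        ≤ 2 ^ (Fintype.card {i // p i}) / √r := by
    intro z
    refine le_trans ?_ (choose_half_le _ r hr hs)
    have := LO0 (fun i : {i // p i} => a i) c (fun i => i.2)
    refine le_trans (le_of_eq ?_) (Nat.cast_le.2 this)
    congr 2
    ext y
    simp only [Finset.mem_filter, Finset.mem_univ, true_and]
    have : ∑ i, a i * bv (e.symm (y, z) i) = ∑ i : {i // p i}, a i * bv (y i) := by
      rw [← Fintype.sum_subtype_add_sum_subtype p]
      have h0 : ∑ i : {i // ¬ p i}, a i * bv (e.symm (y, z) i) = 0 := by
        apply Finset.sum_eq_zero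
        intro i _
        have : a i = 0 := not_not.1 i.2
        simp [this]
      rw [h0, add_zero]
      apply Finset.sum_congr rfl
      intro i _
      simp [e, Equiv.piEquivPiSubtypeProd, i.2]
    rw [this]
  push_cast
  refine (Finset.sum_le_sum (fun z _ => key z)).trans (le_of_eq ?_)
  have hc : Fintype.card {i // p i} + Fintype.card {i // ¬ p i} = Fintype.card ι := by
    rw [← Fintype.card_sum]
    exact Fintype.card_congr (Equiv.sumCompl p)
  rw [Finset.sum_const, ← hc, pow_add]
  simp
  ring

/-- decoupled bound -/
lemma decouple {σ τ : Type*} [Fintype σ] [Fintype τ] (B : σ → τ → ℝ)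
    (g : (σ → Bool) → ℝ) (h : (τ → Bool) → ℝ) (r : ℝ) (hr : 0 < r)
    (hσ : r ≤ Fintype.card σ)
    (hB : ∀ i, r ≤ (Finset.univ.filter (fun j => B i j ≠ 0)).card) :
    ((Finset.univ.filter (fun w : (σ → Bool) × (τ → Bool) =>
      g w.1 + ∑ i, (∑ j, B i j * bv (w.2 j)) * bv (w.1 i) + h w.2 = 0)).card : ℝ)^2
      ≤ (2 ^ (Fintype.card σ) * 2 ^ (Fintype.card τ))^2 * (4 / √r) := by
  set E : (σ → Bool) → (τ → Bool) → Prop := fun y z =>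
      g y + ∑ i, (∑ j, B i j * bv (z j)) * bv (y i) + h z = 0 with hE
  have hcount : ((Finset.univ.filter (fun w : (σ → Bool) × (τ → Bool) => E w.1 w.2)).card : ℝ)
      = ∑ y, ∑ z, (if E y z then (1:ℝ) else 0) := by
    rw [Finset.card_filter]
    push_cast
    rw [Fintype.sum_prod_type]
  rw [hcount]
  have hsr : 0 < √r := Real.sqrt_pos.2 hr
  -- number of zeros
  let D : (τ → Bool) → (τ → Bool) → σ → ℝ := fun z z' i => ∑ j, B i j * bv (z j) - ∑ j, B i j * bv (z' j)
  have hD : ∀ y z z', E y z → E y z' → ∑ i, D z z' i * bv (y i) = h z' - h z := by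
    intro y z z' h1 h2
    simp only [hE] at h1 h2
    simp only [D, sub_mul, Finset.sum_sub_distrib]
    linarith
  have hz : ∀ z' : τ → Bool, ∑ z, ∑ y, (if E y z ∧ E y z' then (1:ℝ) else 0)
      ≤ 2 ^ (Fintype.card σ) * 2 ^ (Fintype.card τ) * (4 / √r) := by
    intro z'
    let Z : (τ → Bool) → Prop := fun z => r / 2 ≤ (Finset.univ.filter (fun i => D z z' i ≠ 0)).card
    have h1 : ∀ z, ∑ y, (if E y z ∧ E y z' then (1:ℝ) else 0) ≤
        2 ^ (Fintype.card σ) / √(r/2) + (if Z z then 0 else 2 ^ (Fintype.card σ)) := by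
      intro z
      by_cases hZ : Z z
      · rw [if_pos hZ, add_zero]
        refine le_trans ?_ (LO (D z z') (h z' - h z) (r/2) (by positivity) hZ)
        rw [Finset.card_filter]
        push_cast
        apply Finset.sum_le_sum
        intro y _
        by_cases hh : E y z ∧ E y z'
        · rw [if_pos hh, if_pos (hD y z z' hh.1 hh.2)]
        · rw [if_neg hh]; positivity
      · rw [if_neg hZ]
        have : ∑ y : σ → Bool, (if E y z ∧ E y z' then (1:ℝ) else 0) ≤ ∑ y : σ → Bool, (1:ℝ) := by
          apply Finset.sum_le_sum
          intro y _
          split_ifs <;> norm_num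
        refine this.trans ?_
        simp
        positivity
    have h2 : ∑ z, (if Z z then (0:ℝ) else 1) ≤ 2 ^ (Fintype.card τ) * (2 / √r) := by
      have hs : (0:ℝ) < Fintype.card σ := lt_of_lt_of_le hr hσ
      have h3 : ∀ z, (Fintype.card σ / 2 : ℝ) * (if Z z then (0:ℝ) else 1) ≤
          ∑ i, (if D z z' i = 0 then (1:ℝ) else 0) := by
        intro z
        by_cases hZ : Z z
        · rw [if_pos hZ, mul_zero]
          apply Finset.sum_nonneg
          intro i _
          split_ifs <;> norm_num
        · rw [if_neg hZ]
          simp only [Z, not_le] at hZ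
          have h4 := Finset.card_filter_add_card_filter_not (s := (Finset.univ : Finset σ)) (fun i => D z z' i = 0)
          have h5 : ((Finset.univ.filter (fun i => D z z' i = 0)).card : ℝ) +
            (Finset.univ.filter (fun i => D z z' i ≠ 0)).card = Fintype.card σ := by
            rw [← Finset.card_univ]; exact_mod_cast h4
          have h6 : ∑ i, (if D z z' i = 0 then (1:ℝ) else 0) = (Finset.univ.filter (fun i => D z z' i = 0)).card := by
            rw [Finset.card_filter]; push_cast; rfl
          rw [h6]
          linarith
      have h7 : ∑ z, ∑ i, (if D z z' i = 0 then (1:ℝ) else 0) ≤ Fintype.card σ * (2 ^ (Fintype.card τ) / √r) := by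
        rw [Finset.sum_comm]
        have : ∀ i ∈ (Finset.univ : Finset σ), ∑ z, (if D z z' i = 0 then (1:ℝ) else 0) ≤ 2 ^ (Fintype.card τ) / √r := by
          intro i _
          refine le_trans (le_of_eq ?_) (LO (B i) (∑ j, B i j * bv (z' j)) r hr (hB i))
          rw [Finset.card_filter]
          push_cast
          apply Finset.sum_congr rfl
          intro z _
          simp only [D, sub_eq_zero]
        refine (Finset.sum_le_sum this).trans ?_
        simp
      have h8 := (Finset.sum_le_sum (fun z (_ : z ∈ (Finset.univ : Finset (τ → Bool))) => h3 z)).trans h7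
      rw [← Finset.mul_sum] at h8
      have h9 : (Fintype.card σ / 2 : ℝ) * ∑ z, (if Z z then (0:ℝ) else 1) ≤
          (Fintype.card σ / 2 : ℝ) * (2 ^ (Fintype.card τ) * (2 / √r)) := by
        refine h8.trans (le_of_eq ?_)
        ring
      exact le_of_mul_le_mul_left h9 (by positivity)
    refine (Finset.sum_le_sum (fun z _ => h1 z)).trans ?_
    rw [Finset.sum_add_distrib]
    have h10 : ∑ z, (if Z z then (0:ℝ) else 2 ^ (Fintype.card σ)) = 2 ^ (Fintype.card σ) * ∑ z, (if Z z then (0:ℝ) else 1) := by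
      rw [Finset.mul_sum]
      apply Finset.sum_congr rfl
      intro z _
      split_ifs <;> simp
    rw [h10]
    have h11 : 1 / √(r/2) ≤ 2 / √r := by
      rw [div_le_div_iff₀ (by positivity) hsr, one_mul]
      refine Real.sqrt_le_iff.2 ⟨by positivity, ?_⟩
      rw [mul_pow, Real.sq_sqrt (by positivity)]
      linarith
    have h12 : ∑ z : τ → Bool, (2:ℝ) ^ (Fintype.card σ) / √(r/2) = 2 ^ (Fintype.card σ) * 2 ^ (Fintype.card τ) * (1 / √(r/2)) := by
      rw [Finset.sum_const, Finset.card_univ, Fintype.card_fun, Fintype.card_bool, nsmul_eq_mul]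
      push_cast
      ring
    rw [h12]
    have h13 := mul_le_mul_of_nonneg_left h11 (show (0:ℝ) ≤ 2 ^ (Fintype.card σ) * 2 ^ (Fintype.card τ) by positivity)
    have h14 := mul_le_mul_of_nonneg_left h2 (show (0:ℝ) ≤ 2 ^ (Fintype.card σ) by positivity)
    calc _ ≤ _ := add_le_add h13 h14
      _ = _ := by ring
  calc (∑ y, ∑ z, (if E y z then (1:ℝ) else 0))^2
      ≤ (2 ^ (Fintype.card σ)) * ∑ y, (∑ z, (if E y z then (1:ℝ) else 0))^2 := by
        have := sq_sum_le_card_mul_sum_sq (s := (Finset.univ : Finset (σ → Bool))) (f := fun y => ∑ z, (if E y z then (1:ℝ) else 0))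
        simpa using this
    _ = (2 ^ (Fintype.card σ)) * ∑ z', ∑ z, ∑ y, (if E y z ∧ E y z' then (1:ℝ) else 0) := by
        congr 1
        have : ∀ y, (∑ z, (if E y z then (1:ℝ) else 0))^2 = ∑ z', ∑ z, (if E y z ∧ E y z' then (1:ℝ) else 0) := by
          intro y
          rw [sq, Finset.sum_mul_sum, Finset.sum_comm]
          apply Finset.sum_congr rfl
          intro z _
          apply Finset.sum_congr rfl
          intro z' _
          by_cases h1 : E y z <;> by_cases h2 : E y z' <;> simp [h1, h2]
        simp only [this]
        rw [Finset.sum_comm]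
        apply Finset.sum_congr rfl
        intro z' _
        rw [Finset.sum_comm]
    _ ≤ (2 ^ (Fintype.card σ)) * ∑ z' : τ → Bool, 2 ^ (Fintype.card σ) * 2 ^ (Fintype.card τ) * (4 / √r) := by
        gcongr with z' _
        exact hz z'
    _ = _ := by
        simp
        ring

/-- quadratic Littlewood-Offord -/
lemma quadLO {ι : Type*} [Fintype ι] (A : ι → ι → ℝ) (hA : ∀ i j, A i j = A j i) (U : ι → Prop)
    (c r : ℝ) (hr : 0 < r) (hU : r ≤ (Finset.univ.filter U).card)
    (hr2 : ∀ i, U i → r ≤ (Finset.univ.filter (fun j => ¬ U j ∧ A i j ≠ 0)).card) :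
    ((Finset.univ.filter (fun y : ι → Bool => ∑ i, ∑ j, A i j * bv (y j) * bv (y i) = c)).card : ℝ)
      ≤ 2 ^ (Fintype.card ι) * √(4 / √r) := by
  let e := Equiv.piEquivPiSubtypeProd U (fun _ => Bool)
  rw [card_filter_equiv e]
  have hc : Fintype.card {i // U i} + Fintype.card {i // ¬ U i} = Fintype.card ι := by
    rw [← Fintype.card_sum]
    exact Fintype.card_congr (Equiv.sumCompl U)
  have key := decouple (fun (i : {i // U i}) (j : {i // ¬ U i}) => 2 * A i j)
    (fun y => ∑ i : {i // U i}, ∑ j : {i // U i}, A i j * bv (y j) * bv (y i))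
    (fun z => ∑ i : {i // ¬ U i}, ∑ j : {i // ¬ U i}, A i j * bv (z j) * bv (z i) - c) r hr
    (by rw [Fintype.card_subtype]; exact hU)
    (by
      intro i
      refine (hr2 i i.2).trans (Nat.cast_le.2 ?_)
      apply le_of_eq
      rw [← Fintype.card_subtype, ← Fintype.card_subtype]
      refine Fintype.card_congr ((Equiv.subtypeSubtypeEquivSubtypeInter (fun j => ¬ U j) (fun j => A i j ≠ 0)).symm.trans (Equiv.subtypeEquivRight ?_))
      intro j
      simp)
  refine (pow_le_pow_iff_left₀ (by positivity) (by positivity) two_ne_zero).1 ?_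
  rw [mul_pow, Real.sq_sqrt (by positivity), ← hc, pow_add]
  refine le_trans (le_of_eq ?_) key
  congr 3
  ext ⟨y, z⟩
  simp only [Finset.mem_filter, Finset.mem_univ, true_and]
  have hy : ∀ i : {i // U i}, e.symm (y, z) i = y i := by
    intro i; simp [e, Equiv.piEquivPiSubtypeProd, i.2]
  have hz : ∀ i : {i // ¬ U i}, e.symm (y, z) i = z i := by
    intro i; simp [e, Equiv.piEquivPiSubtypeProd, i.2]
  have hsum : ∑ i, ∑ j, A i j * bv (e.symm (y, z) j) * bv (e.symm (y, z) i) =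
      ∑ i : {i // U i}, ∑ j : {i // U i}, A i j * bv (y j) * bv (y i)
      + ∑ i : {i // U i}, (∑ j : {i // ¬ U i}, 2 * A i j * bv (z j)) * bv (y i)
      + ∑ i : {i // ¬ U i}, ∑ j : {i // ¬ U i}, A i j * bv (z j) * bv (z i) := by
    rw [← Fintype.sum_subtype_add_sum_subtype U]
    simp_rw [← Fintype.sum_subtype_add_sum_subtype U (fun j => A _ j * bv (e.symm (y, z) j) * _), hy, hz]
    rw [Finset.sum_add_distrib, Finset.sum_add_distrib]
    have : ∑ i : {i // ¬ U i}, ∑ j : {i // U i}, A i j * bv (y j) * bv (z i) =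
      ∑ i : {i // U i}, ∑ j : {i // ¬ U i}, A i j * bv (z j) * bv (y i) := by
      rw [Finset.sum_comm]
      apply Finset.sum_congr rfl
      intro i _
      apply Finset.sum_congr rfl
      intro j _
      rw [hA]; ring
    rw [this]
    simp only [Finset.sum_mul, mul_assoc, ← Finset.mul_sum]
    ring
  rw [hsum]
  constructor <;> intro h <;> linarith

/-- unordered index -/
def uidx {n : ℕ} (i j : Fin n) : UpIdx n := ⟨(min i j, max i j), min_le_max⟩

lemma uidx_eq {n : ℕ} {i j k l : Fin n} (h : uidx i j = uidx k l) :
    (i = k ∧ j = l) ∨ (i = l ∧ j = k) := by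
  simp only [uidx, Subtype.mk.injEq, Prod.mk.injEq] at h
  obtain ⟨h1, h2⟩ := h
  rcases le_total i j with hij | hij <;> rcases le_total k l with hkl | hkl <;>
    simp [hij, hkl] at h1 h2 <;> simp [h1, h2]

lemma uidx_comm {n : ℕ} (i j : Fin n) : uidx i j = uidx j i := by
  simp only [uidx, min_comm, max_comm]

lemma bmat_apply {n : ℕ} (ω : UpIdx n → Bool) (i j : Fin n) : bmat n ω i j = bv (ω (uidx i j)) := rfl

/-- Sparse near-kernel vectors exist. -/
def Bad (n k : ℕ) (ω : UpIdx n → Bool) : Prop :=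
  ∃ v : Fin n → ℝ, v ≠ 0 ∧ (Finset.univ.filter (fun i => v i ≠ 0)).card ≤ k ∧
    ∃ i, ∀ j, j ≠ i → ∑ l, bmat n ω j l * v l = 0

/-- The requirements on the test vector. -/
def VP {n : ℕ} (S T : Finset (Fin n)) (b : Fin n → Fin n → Bool) (v : Fin n → ℝ) : Prop :=
  v ≠ 0 ∧ (∀ l, l ∉ S → v l = 0) ∧ ∀ t ∈ T, ∑ l, bv (b t l) * v l = 0

noncomputable def vec {n : ℕ} (S T : Finset (Fin n)) (b : Fin n → Fin n → Bool) : Fin n → ℝ :=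
  if h : ∃ v, VP S T b v then Classical.choose h else 0

def msk {n : ℕ} (S T : Finset (Fin n)) (ω : UpIdx n → Bool) : Fin n → Fin n → Bool :=
  fun t l => if t ∈ T ∧ l ∈ S then ω (uidx t l) else false

noncomputable def piv {n : ℕ} (i : Fin n) (v : Fin n → ℝ) : Fin n :=
  if h : ∃ l, v l ≠ 0 then Classical.choose h else i

def Ev {n : ℕ} (i : Fin n) (S T : Finset (Fin n)) (ω : UpIdx n → Bool) : Prop :=
  VP S T (msk S T ω) (vec S T (msk S T ω)) ∧
    ∀ j, j ∉ S → j ∉ T → j ≠ i → ∑ l, bmat n ω j l * vec S T (msk S T ω) l = 0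

noncomputable def flp {n : ℕ} (l : Fin n) (F : Finset (Fin n)) (ω : UpIdx n → Bool) : UpIdx n → Bool :=
  fun p => xor (ω p) (decide (∃ j ∈ F, p = uidx j l))

lemma exists_span_rows {ι κ : Type*} [Fintype ι] [Fintype κ] (f : ι → κ → ℝ) :
    ∃ T : Finset ι, T.card ≤ Fintype.card κ ∧
      ∀ w : κ → ℝ, (∀ t ∈ T, ∑ l, f t l * w l = 0) → ∀ j, ∑ l, f j l * w l = 0 := by
  obtain ⟨K, a, ha, hspan, hli⟩ := exists_linearIndependent' ℝ f
  have : Finite K := Finite.of_injective a ha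
  have := Fintype.ofFinite K
  refine ⟨Finset.univ.image a, ?_, ?_⟩
  · refine Finset.card_image_le.trans ?_
    rw [Finset.card_univ]
    simpa using hli.fintype_card_le_finrank
  · intro w hw j
    let φ : (κ → ℝ) →ₗ[ℝ] ℝ := ∑ l, w l • LinearMap.proj l
    have hφ : ∀ x, φ x = ∑ l, x l * w l := by
      intro x; simp [φ, mul_comm]
    have h1 : Submodule.span ℝ (Set.range (f ∘ a)) ≤ LinearMap.ker φ := by
      rw [Submodule.span_le]
      rintro _ ⟨k, rfl⟩
      simp only [SetLike.mem_coe, LinearMap.mem_ker, hφ]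
      exact hw (a k) (Finset.mem_image_of_mem _ (Finset.mem_univ _))
    have h2 : f j ∈ LinearMap.ker φ := h1 (by rw [hspan]; exact Submodule.subset_span ⟨j, rfl⟩)
    rw [LinearMap.mem_ker, hφ] at h2
    exact h2

lemma bad_cover {n k : ℕ} (ω : UpIdx n → Bool) (h : Bad n k ω) :
    ∃ i, ∃ S T : Finset (Fin n), S.card ≤ k ∧ T.card ≤ k ∧ Ev i S T ω := by
  obtain ⟨v, hv, hk, i, hi⟩ := h
  set S := Finset.univ.filter (fun i => v i ≠ 0) with hS
  obtain ⟨T, hT, hspan⟩ := exists_span_rows (fun (t : {j // j ≠ i}) (l : S) => bmat n ω t l)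
  have hsum : ∀ (w : Fin n → ℝ) (b : Fin n → ℝ), (∀ l, l ∉ S → w l = 0) → ∑ l, b l * w l = ∑ l : S, b l * w l := by
    intro w b hw
    rw [Finset.sum_coe_sort S (fun l => b l * w l)]
    symm
    apply Finset.sum_subset (Finset.subset_univ _)
    intro l _ hl
    rw [hw l hl, mul_zero]
  have hmsk : ∀ (w : Fin n → ℝ), (∀ l, l ∉ S → w l = 0) → ∀ t ∈ T.image Subtype.val,
      ∑ l, bv (msk S (T.image Subtype.val) ω t l) * w l = ∑ l, bmat n ω t l * w l := by
    intro w hw t ht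
    apply Finset.sum_congr rfl
    intro l _
    by_cases hl : l ∈ S
    · rw [msk, if_pos ⟨ht, hl⟩, bmat_apply]
    · rw [hw l hl, mul_zero, mul_zero]
  have hvS : ∀ l, l ∉ S → v l = 0 := by
    intro l hl
    by_contra h
    exact hl (by simp [hS, h])
  refine ⟨i, S, T.image Subtype.val, hk, ?_, ?_⟩
  · refine Finset.card_image_le.trans (hT.trans ?_)
    simpa using hk
  · have hex : ∃ v, VP S (T.image Subtype.val) (msk S (T.image Subtype.val) ω) v := by
      refine ⟨v, hv, hvS, ?_⟩
      intro t ht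
      rw [hmsk v hvS t ht]
      obtain ⟨⟨t', ht'⟩, _, rfl⟩ := Finset.mem_image.1 ht
      exact hi _ ht'
    have hvec : VP S (T.image Subtype.val) (msk S (T.image Subtype.val) ω)
        (vec S (T.image Subtype.val) (msk S (T.image Subtype.val) ω)) := by
      rw [vec, dif_pos hex]
      exact Classical.choose_spec hex
    refine ⟨hvec, ?_⟩
    intro j _ _ hji
    rw [hsum _ _ hvec.2.1]
    refine hspan (fun l => vec S (T.image Subtype.val) (msk S (T.image Subtype.val) ω) l) ?_ ⟨j, hji⟩
    intro t ht
    rw [← hsum _ (fun l => bmat n ω t l) hvec.2.1, ← hmsk _ hvec.2.1 t (Finset.mem_image_of_mem _ ht)]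
    exact hvec.2.2 t (Finset.mem_image_of_mem _ ht)

lemma ev_count {n : ℕ} (i : Fin n) (S T : Finset (Fin n)) :
    (Finset.univ.filter (Ev i S T)).card * 2 ^ (Finset.univ \ (S ∪ T ∪ {i})).card
      ≤ Fintype.card (UpIdx n → Bool) := by
  set J := Finset.univ \ (S ∪ T ∪ {i}) with hJ
  have hJm : ∀ j ∈ J, j ∉ S ∧ j ∉ T ∧ j ≠ i := by
    intro j hj
    simp [hJ] at hj
    tauto
  rw [← Finset.card_powerset, ← Finset.card_product, ← Finset.card_univ]
  let G : (UpIdx n → Bool) × Finset (Fin n) → (UpIdx n → Bool) :=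
    fun p => flp (piv i (vec S T (msk S T p.1))) p.2 p.1
  have hpiv : ∀ v : Fin n → ℝ, v ≠ 0 → v (piv i v) ≠ 0 := by
    intro v hv
    have : ∃ l, v l ≠ 0 := Function.ne_iff.1 hv
    rw [piv, dif_pos this]
    exact Classical.choose_spec this
  have hprop : ∀ ω F, Ev i S T ω → F ⊆ J → msk S T (G (ω, F)) = msk S T ω ∧
      ∀ j ∈ J, (j ∈ F ↔ ∑ l, bmat n (G (ω, F)) j l * vec S T (msk S T ω) l ≠ 0) := by
    intro ω F hE hF
    set v := vec S T (msk S T ω) with hv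
    set l0 := piv i v with hl0
    have hvl0 : v l0 ≠ 0 := hpiv v hE.1.1
    have hl0S : l0 ∈ S := by
      by_contra h
      exact hvl0 (hE.1.2.1 _ h)
    have hG : G (ω, F) = flp l0 F ω := rfl
    rw [hG]
    refine ⟨?_, ?_⟩
    · funext t l
      unfold msk
      by_cases h : t ∈ T ∧ l ∈ S
      · rw [if_pos h, if_pos h, flp]
        have : ¬ ∃ j ∈ F, uidx t l = uidx j l0 := by
          rintro ⟨j, hj, he⟩
          rcases uidx_eq he with ⟨h1, h2⟩ | ⟨h1, h2⟩
          · exact (hJm j (hF hj)).2.1 (h1 ▸ h.1)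
          · exact (hJm j (hF hj)).1 (h2 ▸ h.2)
        simp [this]
      · rw [if_neg h, if_neg h]
    · intro j hj
      have hj' := hJm j hj
      have hzero := hE.2 j hj'.1 hj'.2.1 hj'.2.2
      rw [← hv] at hzero
      have hdiff : ∑ l, bmat n (flp l0 F ω) j l * v l
          = (bmat n (flp l0 F ω) j l0 - bmat n ω j l0) * v l0 := by
        rw [← sub_zero (∑ l, bmat n (flp l0 F ω) j l * v l), ← hzero, ← Finset.sum_sub_distrib]
        rw [Finset.sum_eq_single l0]
        · ring
        · intro l _ hl
          have : ¬ ∃ j' ∈ F, uidx j l = uidx j' l0 := by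
            rintro ⟨j', hj'', he⟩
            rcases uidx_eq he with ⟨h1, h2⟩ | ⟨h1, h2⟩
            · exact hl h2
            · exact hj'.1 (h1 ▸ hl0S)
          simp [bmat_apply, flp, this]
        · simp
      rw [hdiff]
      have hmem : (∃ j' ∈ F, uidx j l0 = uidx j' l0) ↔ j ∈ F := by
        constructor
        · rintro ⟨j', hj'', he⟩
          rcases uidx_eq he with ⟨h1, h2⟩ | ⟨h1, h2⟩
          · exact h1 ▸ hj''
          · exact absurd hl0S (h1 ▸ hj'.1)
        · intro h
          exact ⟨j, h, rfl⟩
      simp only [bmat_apply, flp, hmem]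
      by_cases hjF : j ∈ F
      · simp only [hjF, decide_true, Bool.xor_true, true_iff]
        apply mul_ne_zero _ hvl0
        cases ω (uidx j l0) <;> simp [bv]
      · simp [hjF]
  apply Finset.card_le_card_of_injOn G (fun _ _ => Finset.mem_coe.2 (Finset.mem_univ _))
  rintro ⟨ω₁, F₁⟩ h1 ⟨ω₂, F₂⟩ h2 heq
  simp only [Finset.coe_product, Set.mem_prod, Finset.mem_coe, Finset.mem_filter, Finset.mem_univ,
    true_and, Finset.mem_powerset] at h1 h2
  obtain ⟨a1, b1⟩ := hprop ω₁ F₁ h1.1 h1.2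
  obtain ⟨a2, b2⟩ := hprop ω₂ F₂ h2.1 h2.2
  have hm : msk S T ω₁ = msk S T ω₂ := by rw [← a1, ← a2, heq]
  have hF : F₁ = F₂ := by
    ext j
    constructor
    · intro hj
      rw [b2 j (h1.2 hj), ← heq, ← hm, ← b1 j (h1.2 hj)]; exact hj
    · intro hj
      rw [b1 j (h2.2 hj), heq, hm, ← b2 j (h2.2 hj)]; exact hj
  subst hF
  simp only [Prod.mk.injEq, and_true]
  funext p
  have := congrFun heq p
  simp only [G, flp, hm] at this
  simpa using this

lemma small_sets (n k : ℕ) :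
    ((Finset.univ.filter (fun S : Finset (Fin n) => S.card ≤ k)).card : ℝ) ≤ 16 ^ k * (17/16) ^ n := by
  have h := Fintype.sum_pow_mul_eq_add_pow (Fin n) (1/16 : ℝ) 1
  simp only [one_pow, mul_one, Fintype.card_fin] at h
  have h2 : ((Finset.univ.filter (fun S : Finset (Fin n) => S.card ≤ k)).card : ℝ) * (1/16)^k
      ≤ ∑ S : Finset (Fin n), (1/16 : ℝ)^S.card := by
    rw [Finset.card_filter]
    push_cast
    rw [Finset.sum_mul]
    apply Finset.sum_le_sum
    intro S _
    split_ifs with hS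
    · rw [one_mul]
      exact pow_le_pow_of_le_one (by norm_num) (by norm_num) hS
    · rw [zero_mul]; positivity
  rw [h] at h2
  have h3 : (16:ℝ)^k * (1/16)^k = 1 := by rw [← mul_pow]; norm_num
  calc _ = (16:ℝ)^k * (((Finset.univ.filter (fun S : Finset (Fin n) => S.card ≤ k)).card : ℝ) * (1/16)^k) := by
        rw [mul_left_comm, h3, mul_one]
    _ ≤ 16^k * (1/16+1)^n := by gcongr
    _ = _ := by norm_num

lemma bad_count (n k : ℕ) :
    ((Finset.univ.filter (Bad n k)).card : ℝ) * 2 ^ n ≤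
      n * (16 ^ k * (17/16) ^ n)^2 * 2 ^ (2*k+1) * Fintype.card (UpIdx n → Bool) := by
  let P := Finset.univ.filter (fun S : Finset (Fin n) => S.card ≤ k)
  let I := (Finset.univ : Finset (Fin n)) ×ˢ (P ×ˢ P)
  have h1 : Finset.univ.filter (Bad n k) ⊆ I.biUnion (fun q => Finset.univ.filter (Ev q.1 q.2.1 q.2.2)) := by
    intro ω hω
    obtain ⟨i, S, T, hS, hT, hE⟩ := bad_cover ω (Finset.mem_filter.1 hω).2
    rw [Finset.mem_biUnion]
    refine ⟨(i, S, T), ?_, ?_⟩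
    · simp [I, P, hS, hT]
    · simp [hE]
  have h2 : ∀ q ∈ I, (Finset.univ.filter (Ev q.1 q.2.1 q.2.2)).card * 2^n ≤ 2^(2*k+1) * Fintype.card (UpIdx n → Bool) := by
    rintro ⟨i, S, T⟩ hq
    simp only [I, P, Finset.mem_product, Finset.mem_filter, Finset.mem_univ, true_and] at hq
    have h3 := ev_count i S T
    have h4 : n ≤ (Finset.univ \ (S ∪ T ∪ {i})).card + (2*k+1) := by
      have h5 := Finset.card_union_le (S ∪ T) {i}
      have h6 := Finset.card_union_le S T
      have h7 := Finset.le_card_sdiff (S ∪ T ∪ {i}) (Finset.univ : Finset (Fin n))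
      simp only [Finset.card_singleton, Finset.card_univ, Fintype.card_fin] at h5 h7
      omega
    calc (Finset.univ.filter (Ev i S T)).card * 2^n
        ≤ (Finset.univ.filter (Ev i S T)).card * 2^((Finset.univ \ (S ∪ T ∪ {i})).card + (2*k+1)) := by
          gcongr
          norm_num
      _ = 2^(2*k+1) * ((Finset.univ.filter (Ev i S T)).card * 2^((Finset.univ \ (S ∪ T ∪ {i})).card)) := by
          rw [pow_add]; ring
      _ ≤ _ := by gcongr
  have h3 : (Finset.univ.filter (Bad n k)).card * 2^n ≤ I.card * (2^(2*k+1) * Fintype.card (UpIdx n → Bool)) := by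
    calc _ ≤ (∑ q ∈ I, (Finset.univ.filter (Ev q.1 q.2.1 q.2.2)).card) * 2^n := by
          gcongr
          exact (Finset.card_le_card h1).trans Finset.card_biUnion_le
      _ = ∑ q ∈ I, (Finset.univ.filter (Ev q.1 q.2.1 q.2.2)).card * 2^n := Finset.sum_mul _ _ _
      _ ≤ ∑ q ∈ I, 2^(2*k+1) * Fintype.card (UpIdx n → Bool) := Finset.sum_le_sum h2
      _ = _ := by rw [Finset.sum_const, smul_eq_mul]
  have h4 : (I.card : ℝ) ≤ n * (16 ^ k * (17/16) ^ n)^2 := by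
    simp only [I, Finset.card_product, Finset.card_univ, Fintype.card_fin]
    push_cast
    rw [sq]
    have := small_sets n k
    gcongr
  calc ((Finset.univ.filter (Bad n k)).card : ℝ) * 2 ^ n ≤ I.card * (2^(2*k+1) * Fintype.card (UpIdx n → Bool)) := by exact_mod_cast h3
    _ ≤ n * (16 ^ k * (17/16) ^ n)^2 * (2^(2*k+1) * Fintype.card (UpIdx n → Bool)) := by gcongr
    _ = _ := by ring

/-- Splitting off the first row. -/
def splitFun (n : ℕ) (ω : UpIdx (n+1) → Bool) : (UpIdx n → Bool) × (Fin (n+1) → Bool) :=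
  (fun p => ω ⟨(p.1.1.succ, p.1.2.succ), Fin.succ_le_succ_iff.2 p.2⟩, fun j => ω ⟨(0, j), Fin.zero_le j⟩)

lemma splitFun_bij (n : ℕ) : Function.Bijective (splitFun n) := by
  constructor
  · intro ω₁ ω₂ h
    simp only [splitFun, Prod.mk.injEq] at h
    funext ⟨⟨a, b⟩, hab⟩
    revert hab
    refine Fin.cases ?_ (fun a => ?_) a
    · intro hab
      exact congrFun h.2 b
    · refine Fin.cases ?_ (fun b => ?_) b
      · intro hab
        exact absurd hab (by simp)
      · intro hab
        exact congrFun h.1 ⟨(a, b), Fin.succ_le_succ_iff.1 hab⟩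
  · rintro ⟨ω, y⟩
    refine ⟨fun p => if h : p.1.1 = 0 then y p.1.2 else
      ω ⟨(p.1.1.pred h, p.1.2.pred (fun h' => h (Fin.le_zero_iff.1 (h' ▸ p.2)))), by
        rw [Fin.pred_le_pred_iff]; exact p.2⟩, ?_⟩
    simp only [splitFun, Prod.mk.injEq]
    constructor
    · funext p
      simp
    · funext j
      simp

lemma bmat_succ_succ {n : ℕ} (ω : UpIdx (n+1) → Bool) (i j : Fin n) :
    bmat (n+1) ω i.succ j.succ = bmat n (splitFun n ω).1 i j := by
  simp only [bmat_apply, splitFun]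
  congr 2
  rcases le_total i j with h | h <;> simp [uidx, h]

lemma bmat_zero {n : ℕ} (ω : UpIdx (n+1) → Bool) (j : Fin (n+1)) :
    bmat (n+1) ω 0 j = bv ((splitFun n ω).2 j) := by
  simp only [bmat_apply, splitFun]
  congr 2

lemma bmat_symm {n : ℕ} (ω : UpIdx n → Bool) (i j : Fin n) : bmat n ω i j = bmat n ω j i := by
  rw [bmat_apply, bmat_apply, uidx_comm]

/-- corank -/
noncomputable def cork {n : ℕ} (M : Matrix (Fin n) (Fin n) ℝ) : ℕ :=
  Module.finrank ℝ (LinearMap.ker M.mulVecLin)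

lemma cork_le {n : ℕ} (M : Matrix (Fin n) (Fin n) ℝ) : cork M ≤ n := by
  refine (Submodule.finrank_le _).trans ?_
  simp

lemma mem_ker_iff {n : ℕ} (M : Matrix (Fin n) (Fin n) ℝ) (v : Fin n → ℝ) :
    v ∈ LinearMap.ker M.mulVecLin ↔ ∀ i, ∑ j, M i j * v j = 0 := by
  rw [LinearMap.mem_ker, Matrix.mulVecLin_apply, funext_iff]
  rfl

lemma cork_pos_iff {n : ℕ} (M : Matrix (Fin n) (Fin n) ℝ) : 0 < cork M ↔ M.det = 0 := by
  rw [← Matrix.exists_mulVec_eq_zero_iff, cork, Module.finrank_pos_iff, Submodule.nontrivial_iff_ne_bot,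
    Submodule.ne_bot_iff]
  constructor
  · rintro ⟨x, h, h2⟩; exact ⟨x, h2, h⟩
  · rintro ⟨x, h2, h⟩; exact ⟨x, h, h2⟩

lemma finrank_le_of_maps {V W : Type*} [AddCommGroup V] [Module ℝ V] [AddCommGroup W] [Module ℝ W]
    [FiniteDimensional ℝ W] (f : V →ₗ[ℝ] W) (W' : Submodule ℝ W) (h : ∀ v, f v ∈ W')
    (hinj : ∀ v, f v = 0 → v = 0) : Module.finrank ℝ V ≤ Module.finrank ℝ W' := by
  apply LinearMap.finrank_le_finrank_of_injective (f := f.codRestrict W' h)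
  rw [← LinearMap.ker_eq_bot, LinearMap.ker_eq_bot']
  intro v hv
  exact hinj v (congrArg Subtype.val hv)

lemma cork_succ_le {n : ℕ} (M : Matrix (Fin (n+1)) (Fin (n+1)) ℝ) (Q : Matrix (Fin n) (Fin n) ℝ)
    (hQ : ∀ i j, M i.succ j.succ = Q i j) : cork M ≤ cork Q + 1 := by
  let K := LinearMap.ker M.mulVecLin
  let φ : K →ₗ[ℝ] ℝ := (LinearMap.proj 0).comp K.subtype
  have h1 := LinearMap.finrank_range_add_finrank_ker φ
  have h2 : Module.finrank ℝ (LinearMap.range φ) ≤ 1 := by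
    refine (Submodule.finrank_le _).trans ?_
    simp
  have h3 : Module.finrank ℝ (LinearMap.ker φ) ≤ cork Q := by
    refine finrank_le_of_maps (V := ↥(LinearMap.ker φ))
      ((LinearMap.funLeft ℝ ℝ (Fin.succ : Fin n → Fin (n+1))).comp
      (K.subtype.comp (LinearMap.ker φ).subtype)) (LinearMap.ker Q.mulVecLin) ?_ ?_
    · rintro ⟨⟨v, hv⟩, hv0⟩
      have h0 : v 0 = 0 := hv0
      rw [mem_ker_iff]
      intro i
      have := (mem_ker_iff M v).1 hv i.succ
      rw [Fin.sum_univ_succ, h0, mul_zero, zero_add] at this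
      simpa [hQ] using this
    · rintro ⟨⟨v, hv⟩, hv0⟩ h
      have h0 : v 0 = 0 := hv0
      have h4 : v = 0 := by
        funext j
        refine Fin.cases h0 (fun j => ?_) j
        exact congrFun h j
      simp [h4]
  change Module.finrank ℝ K ≤ _
  omega

lemma cork_succ_lt {n : ℕ} (M : Matrix (Fin (n+1)) (Fin (n+1)) ℝ) (Q : Matrix (Fin n) (Fin n) ℝ)
    (hQ : ∀ i j, M i.succ j.succ = Q i j) (hM : ∀ i j, M i j = M j i) (v : Fin n → ℝ)
    (hv : v ∈ LinearMap.ker Q.mulVecLin) (hx : ∑ j, M 0 j.succ * v j ≠ 0) : cork M + 1 ≤ cork Q := by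
  let ψ : (Fin n → ℝ) →ₗ[ℝ] ℝ := ∑ j, (M 0 j.succ) • LinearMap.proj j
  have hψ : ∀ w, ψ w = ∑ j, M 0 j.succ * w j := by intro w; simp [ψ]
  let W := LinearMap.ker Q.mulVecLin ⊓ LinearMap.ker ψ
  have hW : Module.finrank ℝ W < cork Q := by
    apply Submodule.finrank_lt_finrank_of_lt
    refine lt_of_le_of_ne inf_le_left ?_
    intro h
    rw [← h] at hv
    exact hx ((hψ v).symm.trans hv.2)
  have hz : ∀ w ∈ LinearMap.ker M.mulVecLin, w 0 = 0 := by
    intro w hw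
    have h1 := (mem_ker_iff M w).1 hw
    have h2 := (mem_ker_iff Q v).1 hv
    have h3 : ∑ i : Fin n, v i * (∑ j, M i.succ j * w j) = 0 := by simp [h1]
    simp only [Fin.sum_univ_succ, hQ, mul_add, Finset.sum_add_distrib] at h3
    have h4 : ∑ i : Fin n, v i * ∑ j : Fin n, Q i j * w j.succ = 0 := by
      simp only [Finset.mul_sum]
      rw [Finset.sum_comm]
      apply Finset.sum_eq_zero
      intro j _
      calc ∑ i, v i * (Q i j * w j.succ) = w j.succ * ∑ i, Q j i * v i := by
            rw [Finset.mul_sum]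
            apply Finset.sum_congr rfl
            intro i _
            rw [← hQ i j, hM, hQ]; ring
        _ = 0 := by rw [h2, mul_zero]
    rw [h4, add_zero] at h3
    have h5 : (∑ j, M 0 j.succ * v j) * w 0 = 0 := by
      rw [← h3, Finset.sum_mul]
      apply Finset.sum_congr rfl
      intro i _
      rw [hM]; ring
    exact (mul_eq_zero.1 h5).resolve_left hx
  have h3 : cork M ≤ Module.finrank ℝ W := by
    apply finrank_le_of_maps ((LinearMap.funLeft ℝ ℝ (Fin.succ : Fin n → Fin (n+1))).comp
      (LinearMap.ker M.mulVecLin).subtype)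
    · rintro ⟨w, hw⟩
      have h0 := hz w hw
      have h1 := (mem_ker_iff M w).1 hw
      refine ⟨?_, ?_⟩
      · rw [SetLike.mem_coe, mem_ker_iff]
        intro i
        have := h1 i.succ
        rw [Fin.sum_univ_succ, h0, mul_zero, zero_add] at this
        simpa [hQ] using this
      · have := h1 0
        rw [Fin.sum_univ_succ, h0, mul_zero, zero_add] at this
        rw [SetLike.mem_coe, LinearMap.mem_ker, hψ]
        exact this
    · rintro ⟨w, hw⟩ h
      have h4 : w = 0 := by
        funext j
        refine Fin.cases (hz w hw) (fun j => ?_) j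
        exact congrFun h j
      simp [h4]
  omega

lemma det_succ_zero {n : ℕ} (M : Matrix (Fin (n+1)) (Fin (n+1)) ℝ) (Q : Matrix (Fin n) (Fin n) ℝ)
    (hQ : ∀ i j, M i.succ j.succ = Q i j) (hM : ∀ i j, M i j = M j i) (hd : Q.det ≠ 0)
    (hMd : M.det = 0) :
    ∑ i, ∑ j, Q⁻¹ i j * M 0 j.succ * M 0 i.succ = M 0 0 := by
  obtain ⟨w, hw0, hw⟩ := Matrix.exists_mulVec_eq_zero_iff.2 hMd
  let x : Fin n → ℝ := fun i => M 0 i.succ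
  let u : Fin n → ℝ := fun i => w i.succ
  have hU : IsUnit Q.det := isUnit_iff_ne_zero.2 hd
  have h1 : w 0 • x + Q.mulVec u = 0 := by
    funext i
    have := congrFun hw i.succ
    simp only [Matrix.mulVec, dotProduct, Fin.sum_univ_succ, hQ] at this
    simp only [Matrix.mulVec, dotProduct, Pi.add_apply, Pi.smul_apply, smul_eq_mul, x, u]
    rw [hM 0 i.succ]
    linarith [this, show (0 : Fin (n+1) → ℝ) i.succ = 0 from rfl, show (0 : Fin n → ℝ) i = 0 from rfl]
  have h2 : M 0 0 * w 0 + x ⬝ᵥ u = 0 := by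
    have := congrFun hw 0
    simp only [Matrix.mulVec, dotProduct, Fin.sum_univ_succ] at this
    exact this
  have h3 : u = -(w 0 • (Q⁻¹).mulVec x) := by
    have h4 : (Q⁻¹).mulVec (w 0 • x + Q.mulVec u) = 0 := by rw [h1, Matrix.mulVec_zero]
    rw [Matrix.mulVec_add, Matrix.mulVec_smul, Matrix.mulVec_mulVec, Matrix.nonsing_inv_mul _ hU,
      Matrix.one_mulVec] at h4
    exact eq_neg_of_add_eq_zero_right h4
  have hw00 : w 0 ≠ 0 := by
    intro h
    rw [h, zero_smul, neg_zero] at h3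
    apply hw0
    funext j
    refine Fin.cases h (fun j => ?_) j
    exact congrFun h3 j
  rw [h3, dotProduct_neg, dotProduct_smul, smul_eq_mul] at h2
  have h5 : w 0 * (x ⬝ᵥ (Q⁻¹).mulVec x) = w 0 * M 0 0 := by linarith
  have h6 := mul_left_cancel₀ hw00 h5
  rw [← h6]
  simp only [dotProduct, Matrix.mulVec, x, Finset.mul_sum]
  apply Finset.sum_congr rfl
  intro i _
  apply Finset.sum_congr rfl
  intro j _
  ring

noncomputable def fpot (j : ℕ) : ℝ := if j = 0 then 0 else (5/4)^j

lemma fpot_nonneg (j : ℕ) : 0 ≤ fpot j := by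
  unfold fpot; split_ifs <;> positivity

lemma fpot_le (j N : ℕ) (h : j ≤ N) : fpot j ≤ (5/4)^N := by
  unfold fpot
  split_ifs
  · positivity
  · exact pow_le_pow_right₀ (by norm_num) h

lemma bv_sq (b : Bool) : bv b * bv b = bv b := by cases b <;> simp [bv]

/-- splitting equivalence -/
noncomputable def splitE (n : ℕ) : (UpIdx (n+1) → Bool) ≃ (UpIdx n → Bool) × (Fin (n+1) → Bool) :=
  Equiv.ofBijective _ (splitFun_bij n)

lemma splitFun_symm {n : ℕ} (ω : UpIdx n → Bool) (y : Fin (n+1) → Bool) :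
    splitFun n ((splitE n).symm (ω, y)) = (ω, y) :=
  (splitE n).apply_symm_apply (ω, y)

lemma step_sing {n u : ℕ} (hu : 1 ≤ u) (ω : UpIdx n → Bool) (hg : ¬ Bad n (2*u) ω)
    (hs : 0 < cork (bmat n ω)) :
    ∑ y, fpot (cork (bmat (n+1) ((splitE n).symm (ω, y)))) ≤
      2^(n+1) * ((4/5 + (5/4)/√u) * fpot (cork (bmat n ω))) := by
  have hdet := (cork_pos_iff _).1 hs
  obtain ⟨v, hv0, hv⟩ := Matrix.exists_mulVec_eq_zero_iff.2 hdet
  have hvk : v ∈ LinearMap.ker (bmat n ω).mulVecLin := hv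
  obtain ⟨i0, _⟩ := Function.ne_iff.1 hv0
  have hsupp : 2*u < (Finset.univ.filter (fun i => v i ≠ 0)).card := by
    by_contra! h
    exact hg ⟨v, hv0, h, i0, fun j _ => (mem_ker_iff _ _).1 hvk j⟩
  set j := cork (bmat n ω) with hj
  have hF : fpot j = (5/4)^j := by rw [fpot, if_neg hs.ne']
  let a : Fin (n+1) → ℝ := Fin.cases 0 v
  have ha : (u:ℝ) ≤ (Finset.univ.filter (fun i => a i ≠ 0)).card := by
    have : (Finset.univ.filter (fun i => v i ≠ 0)).card ≤ (Finset.univ.filter (fun i => a i ≠ 0)).card := by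
      apply Finset.card_le_card_of_injOn Fin.succ
      · intro i hi
        simpa [a] using hi
      · exact (Fin.succ_injective n).injOn
    exact_mod_cast (by omega : u ≤ (Finset.univ.filter (fun i => a i ≠ 0)).card)
  have hLO := LO a 0 u (by exact_mod_cast hu) ha
  have hterm : ∀ y : Fin (n+1) → Bool, fpot (cork (bmat (n+1) ((splitE n).symm (ω, y)))) ≤
      4/5 * (5/4)^j + 5/4*(5/4)^j * (if ∑ i, a i * bv (y i) = 0 then 1 else 0) := by
    intro y
    have hsp := splitFun_symm ω y
    set ω' := (splitE n).symm (ω, y) with hω'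
    have hQ : ∀ i j, bmat (n+1) ω' (Fin.succ i) (Fin.succ j) = bmat n ω i j := by
      intro i j
      rw [bmat_succ_succ, hsp]
    split_ifs with hz
    · refine (fpot_le _ (j+1) (cork_succ_le _ _ hQ)).trans ?_
      rw [pow_succ]
      have : (0:ℝ) ≤ (5/4)^j := by positivity
      linarith
    · have hlt := cork_succ_lt (bmat (n+1) ω') (bmat n ω) hQ (bmat_symm ω') v hvk (by
        intro h
        apply hz
        rw [Fin.sum_univ_succ]
        simp only [a, Fin.cases_zero, Fin.cases_succ, zero_mul, zero_add]
        rw [← h]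
        apply Finset.sum_congr rfl
        intro i _
        rw [bmat_zero, hsp]; ring)
      refine (fpot_le _ (j-1) (by omega)).trans ?_
      obtain ⟨j', hj'⟩ : ∃ j', j = j'+1 := ⟨j-1, by omega⟩
      rw [hj', Nat.add_sub_cancel, pow_succ]
      apply le_of_eq
      ring
  refine (Finset.sum_le_sum (fun y _ => hterm y)).trans ?_
  rw [Finset.sum_add_distrib, ← Finset.mul_sum _ _ (5/4 * (5/4)^j)]
  have hcard : ∑ y : Fin (n+1) → Bool, (if ∑ i, a i * bv (y i) = 0 then (1:ℝ) else 0) ≤ 2^(n+1) / √u := by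
    refine le_trans (le_of_eq ?_) (by simpa using hLO)
    rw [Finset.card_filter]; push_cast; congr!
  have h1 : ∑ y : Fin (n+1) → Bool, (4/5 * (5/4)^j : ℝ) = 2^(n+1) * (4/5 * (5/4)^j) := by simp
  rw [h1, hF]
  calc _ ≤ 2^(n+1) * (4/5 * (5/4)^j) + 5/4 * (5/4)^j * (2^(n+1) / √(u:ℝ)) := by gcongr
    _ = _ := by ring

lemma step_nonsing {n u : ℕ} (hu : 1 ≤ u) (hun : u ≤ n) (ω : UpIdx n → Bool) (hg : ¬ Bad n (2*u) ω)
    (hs : cork (bmat n ω) = 0) :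
    ∑ y, fpot (cork (bmat (n+1) ((splitE n).symm (ω, y)))) ≤
      2^(n+1) * (5/4 * √(4/√u)) := by
  have hdet : (bmat n ω).det ≠ 0 := by
    intro h
    have := (cork_pos_iff _).2 h
    omega
  set Q := bmat n ω with hQdef
  have hU : IsUnit Q.det := isUnit_iff_ne_zero.2 hdet
  have hQs : Q.transpose = Q := by
    ext i j
    exact bmat_symm ω j i
  have hIs : ∀ i j, Q⁻¹ i j = Q⁻¹ j i := by
    intro i j
    have : (Q⁻¹).transpose = Q⁻¹ := by rw [Matrix.transpose_nonsing_inv, hQs]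
    exact congrFun (congrFun this j) i
  have hsupp : ∀ i, 2*u < (Finset.univ.filter (fun j => Q⁻¹ i j ≠ 0)).card := by
    intro i
    by_contra! h
    apply hg
    have hmul : ∀ j, ∑ l, Q j l * Q⁻¹ i l = (1 : Matrix (Fin n) (Fin n) ℝ) j i := by
      intro j
      rw [← Matrix.mul_nonsing_inv Q hU, Matrix.mul_apply]
      apply Finset.sum_congr rfl
      intro l _
      rw [hIs]
    refine ⟨fun l => Q⁻¹ i l, ?_, h, i, ?_⟩
    · intro h0
      have h1 := hmul i
      have h2 : ∀ l, Q⁻¹ i l = 0 := fun l => congrFun h0 l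
      simp [h2] at h1
    · intro j hj
      rw [← hQdef, hmul j, Matrix.one_apply_ne hj]
  obtain ⟨U0, hU0⟩ : ∃ U0 : Finset (Fin n), U0.card = u := by
    obtain ⟨U0, _, h⟩ := Finset.exists_subset_card_eq (s := (Finset.univ : Finset (Fin n))) (n := u) (by simpa using hun)
    exact ⟨U0, h⟩
  let A : Fin (n+1) → Fin (n+1) → ℝ := fun i j =>
    Fin.cases (Fin.cases (-1) (fun _ => 0) j) (fun i' => Fin.cases 0 (fun j' => Q⁻¹ i' j') j) i
  have hA00 : A 0 0 = -1 := rfl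
  have hA0s : ∀ j : Fin n, A 0 j.succ = 0 := fun j => rfl
  have hAs0 : ∀ j : Fin n, A j.succ 0 = 0 := fun j => rfl
  have hAss : ∀ i j : Fin n, A i.succ j.succ = Q⁻¹ i j := fun i j => rfl
  let U : Fin (n+1) → Prop := fun i => ∃ i' ∈ U0, i = i'.succ
  have hUs : ∀ j : Fin n, U j.succ ↔ j ∈ U0 := by
    intro j
    constructor
    · rintro ⟨i', h, he⟩
      rw [Fin.succ_inj] at he
      exact he ▸ h
    · intro h
      exact ⟨j, h, rfl⟩
  have hLO := quadLO A (by
      intro i j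
      refine Fin.cases ?_ (fun i => ?_) i <;> refine Fin.cases ?_ (fun j => ?_) j
      · rfl
      · rw [hA0s, hAs0]
      · rw [hA0s, hAs0]
      · rw [hAss, hAss, hIs]) U 0 u (by exact_mod_cast hu) (by
      have : U0.card ≤ (Finset.univ.filter U).card := by
        apply Finset.card_le_card_of_injOn Fin.succ
        · intro i hi
          simpa [hUs] using hi
        · exact (Fin.succ_injective n).injOn
      rw [hU0] at this
      refine Nat.cast_le.2 ?_
      convert this) (by
      rintro _ ⟨i, hi, rfl⟩
      have h1 : (Finset.univ.filter (fun j => Q⁻¹ i j ≠ 0) \ U0).card ≤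
          (Finset.univ.filter (fun j => ¬ U j ∧ A i.succ j ≠ 0)).card := by
        apply Finset.card_le_card_of_injOn Fin.succ
        · intro j hj
          simp only [Finset.coe_sdiff, Set.mem_sdiff, Finset.mem_coe, Finset.mem_filter, Finset.mem_univ, true_and] at hj
          simp only [Finset.mem_coe, Finset.mem_filter, Finset.mem_univ, true_and, hUs, hAss]
          exact ⟨hj.2, hj.1⟩
        · exact (Fin.succ_injective n).injOn
      have h2 := Finset.le_card_sdiff U0 (Finset.univ.filter (fun j => Q⁻¹ i j ≠ 0))
      have h3 := hsupp i
      exact_mod_cast (by omega : u ≤ (Finset.univ.filter (fun j => ¬ U j ∧ A i.succ j ≠ 0)).card))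
  have hterm : ∀ y : Fin (n+1) → Bool, fpot (cork (bmat (n+1) ((splitE n).symm (ω, y)))) ≤
      5/4 * (if ∑ i, ∑ j, A i j * bv (y j) * bv (y i) = 0 then 1 else 0) := by
    intro y
    have hsp := splitFun_symm ω y
    set ω' := (splitE n).symm (ω, y) with hω'
    have hQ : ∀ i j, bmat (n+1) ω' (Fin.succ i) (Fin.succ j) = Q i j := by
      intro i j
      rw [bmat_succ_succ, hsp]
    have h1 : cork (bmat (n+1) ω') ≤ 1 := by
      have := cork_succ_le _ _ hQ
      omega
    split_ifs with hz
    · refine (fpot_le _ 1 h1).trans ?_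
      norm_num
    · have : cork (bmat (n+1) ω') = 0 := by
        by_contra hne
        apply hz
        have hd := (cork_pos_iff _).1 (Nat.pos_of_ne_zero hne)
        have h2 := det_succ_zero _ Q hQ (bmat_symm ω') hdet hd
        simp only [bmat_zero, hsp] at h2
        simp only [Fin.sum_univ_succ, hA00, hA0s, hAs0, hAss, zero_mul, Finset.sum_const_zero, zero_add, add_zero]
        rw [h2, mul_assoc, bv_sq]
        ring
      rw [this]
      simp [fpot]
  refine (Finset.sum_le_sum (fun y _ => hterm y)).trans ?_
  rw [← Finset.mul_sum]
  have hcard : ∑ y : Fin (n+1) → Bool, (if ∑ i, ∑ j, A i j * bv (y j) * bv (y i) = 0 then (1:ℝ) else 0) ≤ 2^(n+1) * √(4/√u) := by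
    refine le_trans (le_of_eq ?_) (by simpa only [Fintype.card_fin] using hLO)
    rw [Finset.card_filter]; push_cast; congr!
  calc _ ≤ 5/4 * (2^(n+1) * √(4/√u)) := by gcongr
    _ = _ := by ring

/-- averaged potential -/
noncomputable def pot (n : ℕ) : ℝ :=
  (∑ ω : UpIdx n → Bool, fpot (cork (bmat n ω))) / (Fintype.card (UpIdx n → Bool) : ℝ)

lemma pot_step {n u : ℕ} (hu : 1 ≤ u) (hun : u ≤ n) :
    pot (n+1) ≤ (4/5 + (5/4)/√u) * pot n + 5/4 * √(4/√u) +
      (5/4)^(n+1) * (n * (16 ^ (2*u) * (17/16) ^ n)^2 * 2 ^ (2*(2*u)+1) / 2^n) := by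
  set Ω : ℝ := (Fintype.card (UpIdx n → Bool) : ℝ) with hΩ
  have hΩpos : 0 < Ω := by
    rw [hΩ]; exact_mod_cast Fintype.card_pos
  have hcard : (Fintype.card (UpIdx (n+1) → Bool) : ℝ) = Ω * 2^(n+1) := by
    rw [Fintype.card_congr (splitE n), Fintype.card_prod, hΩ]
    simp
  have hterm : ∀ ω : UpIdx n → Bool,
      ∑ y, fpot (cork (bmat (n+1) ((splitE n).symm (ω, y)))) ≤
      2^(n+1) * ((4/5 + (5/4)/√u) * fpot (cork (bmat n ω)) + 5/4 * √(4/√u) +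
        (5/4)^(n+1) * (if Bad n (2*u) ω then 1 else 0)) := by
    intro ω
    have p1 : 0 ≤ (4/5 + (5/4)/√(u:ℝ)) * fpot (cork (bmat n ω)) := mul_nonneg (by positivity) (fpot_nonneg _)
    have p2 : 0 ≤ 5/4 * √(4/√(u:ℝ)) := by positivity
    by_cases hb : Bad n (2*u) ω
    · rw [if_pos hb, mul_one]
      have : ∀ y : Fin (n+1) → Bool, fpot (cork (bmat (n+1) ((splitE n).symm (ω, y)))) ≤ (5/4)^(n+1) :=
        fun y => fpot_le _ _ (cork_le _)
      refine (Finset.sum_le_sum (fun y _ => this y)).trans ?_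
      have h2 : ∑ y : Fin (n+1) → Bool, ((5/4)^(n+1) : ℝ) = 2^(n+1) * (5/4)^(n+1) := by simp
      rw [h2]
      gcongr
      linarith
    · rw [if_neg hb, mul_zero, add_zero]
      rcases Nat.eq_zero_or_pos (cork (bmat n ω)) with h | h
      · refine (step_nonsing hu hun ω hb h).trans ?_
        gcongr
        linarith
      · refine (step_sing hu ω hb h).trans ?_
        gcongr
        linarith
  have hsum : ∑ ω : UpIdx (n+1) → Bool, fpot (cork (bmat (n+1) ω)) =
      ∑ ω : UpIdx n → Bool, ∑ y, fpot (cork (bmat (n+1) ((splitE n).symm (ω, y)))) := by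
    rw [← Fintype.sum_prod_type']
    exact Fintype.sum_equiv (splitE n) _ _ (fun ω => by simp)
  have hbad := bad_count n (2*u)
  rw [← hΩ] at hbad
  have hbad2 : ∑ ω, (if Bad n (2*u) ω then (1:ℝ) else 0) ≤
      (n * (16 ^ (2*u) * (17/16) ^ n)^2 * 2 ^ (2*(2*u)+1) / 2^n) * Ω := by
    have : ∑ ω, (if Bad n (2*u) ω then (1:ℝ) else 0) = (Finset.univ.filter (Bad n (2*u))).card := by
      rw [Finset.card_filter]; push_cast; rfl
    rw [this, div_mul_eq_mul_div, le_div_iff₀ (by positivity)]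
    exact hbad
  rw [pot, hcard, hsum, div_le_iff₀ (by positivity)]
  refine (Finset.sum_le_sum (fun ω _ => hterm ω)).trans ?_
  rw [← Finset.mul_sum, Finset.sum_add_distrib, Finset.sum_add_distrib,
    ← Finset.mul_sum _ _ (4/5 + (5/4)/√(u:ℝ)), ← Finset.mul_sum _ _ ((5/4 : ℝ)^(n+1))]
  have h1 : ∑ ω : UpIdx n → Bool, fpot (cork (bmat n ω)) = pot n * Ω := by
    rw [pot, div_mul_cancel₀ _ hΩpos.ne']
  have h2 : ∑ ω : UpIdx n → Bool, (5/4 * √(4/√(u:ℝ))) = Ω * (5/4 * √(4/√(u:ℝ))) := by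
    rw [Finset.sum_const, nsmul_eq_mul, Finset.card_univ]
  rw [h1, h2]
  have h3 := mul_le_mul_of_nonneg_left hbad2 (show (0:ℝ) ≤ (5/4)^(n+1) by positivity)
  calc _ ≤ 2^(n+1) * ((4/5 + (5/4)/√(u:ℝ)) * (pot n * Ω) + Ω * (5/4 * √(4/√(u:ℝ))) +
        (5/4)^(n+1) * ((n * (16 ^ (2*u) * (17/16) ^ n)^2 * 2 ^ (2*(2*u)+1) / 2^n) * Ω)) := by
        gcongr
    _ = _ := by ring

lemma prob_le_pot (n : ℕ) : unifProb (fun ω : UpIdx n → Bool => (bmat n ω).det = 0) ≤ pot n := by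
  unfold unifProb pot
  gcongr
  rw [Finset.card_filter]
  push_cast
  apply Finset.sum_le_sum
  intro ω _
  split_ifs with h
  · have := (cork_pos_iff _).2 h
    rw [fpot, if_neg this.ne']
    exact one_le_pow₀ (by norm_num)
  · exact fpot_nonneg _

lemma pot_le (n : ℕ) : pot n ≤ (5/4)^n := by
  unfold pot
  rw [div_le_iff₀ (by exact_mod_cast Fintype.card_pos)]
  refine (Finset.sum_le_sum (fun ω _ => fpot_le _ n (cork_le _))).trans ?_
  rw [Finset.sum_const, nsmul_eq_mul, Finset.card_univ, mul_comm]

noncomputable def sd (n : ℕ) : ℝ := √(1/√(n:ℝ))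

lemma sd_step (n : ℕ) (hn : 20 ≤ n) : 0.95 * sd n ≤ sd (n+1) := by
  have hn' : (20:ℝ) ≤ n := by exact_mod_cast hn
  unfold sd
  apply Real.le_sqrt_of_sq_le
  rw [mul_pow, Real.sq_sqrt (by positivity), mul_one_div, div_le_div_iff₀ (by positivity) (by positivity), one_mul]
  apply Real.le_sqrt_of_sq_le
  rw [mul_pow, Real.sq_sqrt (by positivity)]
  push_cast
  norm_num
  linarith

lemma sd_anti {m n : ℕ} (hm : 1 ≤ m) (h : m ≤ n) : sd n ≤ sd m := by
  unfold sd
  have : (0:ℝ) < m := by exact_mod_cast hm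
  apply Real.sqrt_le_sqrt
  apply one_div_le_one_div_of_le (by positivity)
  apply Real.sqrt_le_sqrt
  exact_mod_cast h

lemma sd_pos {n : ℕ} (hn : 1 ≤ n) : 0 < sd n := by
  have : (0:ℝ) < n := by exact_mod_cast hn
  unfold sd; positivity

lemma sd_ge {n : ℕ} (hn : 1 ≤ n) : 1 / (n:ℝ) ≤ sd n := by
  have h1 : (1:ℝ) ≤ n := by exact_mod_cast hn
  unfold sd
  apply Real.le_sqrt_of_sq_le
  rw [div_pow, one_pow]
  apply one_div_le_one_div_of_le (by positivity)
  rw [Real.sqrt_le_iff]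
  constructor
  · positivity
  · have : (1:ℝ) ≤ n^2 := by nlinarith
    nlinarith [sq_nonneg ((n:ℝ)^2 - 1)]

lemma recur : ∃ N0 : ℕ, 20 ≤ N0 ∧ ∃ C : ℝ, 0 ≤ C ∧ ∀ n, N0 ≤ n → pot (n+1) ≤ 0.9 * pot n + C * sd n := by
  have ht := tendsto_pow_const_mul_const_pow_of_lt_one 2 (show (0:ℝ) ≤ 6/5 * (5/4 * (17/16)^2 / 2) by norm_num)
    (show (6/5 * (5/4 * (17/16)^2 / 2) : ℝ) < 1 by norm_num)
  obtain ⟨C0, hC0⟩ := ht.bddAbove_range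
  have hC0' : ∀ n : ℕ, (n:ℝ)^2 * (6/5 * (5/4 * (17/16)^2 / 2))^n ≤ C0 := fun n => hC0 ⟨n, rfl⟩
  have hC0n : 0 ≤ C0 := by simpa using hC0' 0
  refine ⟨20000, by norm_num, 10 + 5/2 * C0, by positivity, ?_⟩
  intro n hn
  have hn1 : 1 ≤ n := by omega
  set u := n / 100 with hu
  have hu1 : 200 ≤ u := by omega
  have hu2 : 100 * u ≤ n := by omega
  have hu3 : n ≤ 200 * u := by omega
  have hur : (200:ℝ) ≤ u := by exact_mod_cast hu1
  have hnr : (n:ℝ) ≤ 200 * u := by exact_mod_cast hu3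
  have hnp : (0:ℝ) < n := by exact_mod_cast hn1
  have h := pot_step (n := n) (u := u) (by omega) (by omega)
  have hpot : 0 ≤ pot n := by
    unfold pot
    exact div_nonneg (Finset.sum_nonneg (fun _ _ => fpot_nonneg _)) (by positivity)
  have e1 : (5/4)/√(u:ℝ) ≤ 0.1 := by
    rw [div_le_iff₀ (by positivity)]
    have : (14:ℝ) ≤ √u := by
      apply Real.le_sqrt_of_sq_le
      linarith
    linarith
  have e2 : √(4/√(u:ℝ)) ≤ 8 * sd n := by
    unfold sd
    rw [show (8:ℝ) = √64 by rw [show (64:ℝ) = 8^2 by norm_num]; simp, ← Real.sqrt_mul (by norm_num)]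
    apply Real.sqrt_le_sqrt
    rw [mul_one_div, div_le_div_iff₀ (by positivity) (by positivity)]
    have : √(n:ℝ) ≤ 16 * √(u:ℝ) := by
      rw [Real.sqrt_le_iff]
      refine ⟨by positivity, ?_⟩
      rw [mul_pow, Real.sq_sqrt (by positivity)]
      linarith
    linarith
  have e3 : (5/4:ℝ)^(n+1) * (n * (16 ^ (2*u) * (17/16) ^ n)^2 * 2 ^ (2*(2*u)+1) / 2^n) ≤ 5/2 * C0 * sd n := by
    have f1 : (2^20 : ℝ)^u ≤ (6/5)^n := by
      calc (2^20 : ℝ)^u ≤ ((6/5)^100)^u := by gcongr; norm_num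
        _ = (6/5)^(100*u) := by rw [pow_mul]
        _ ≤ _ := pow_le_pow_right₀ (by norm_num) hu2
    have f0 : ((16:ℝ) ^ (2*u))^2 * 2 ^ (2*(2*u)) = (2^20)^u := by
      rw [show (16:ℝ) = 2^4 by norm_num]
      simp only [← pow_mul, ← pow_add]
      congr 1
      ring
    have f2 : (5/4:ℝ)^(n+1) * (n * (16 ^ (2*u) * (17/16) ^ n)^2 * 2 ^ (2*(2*u)+1) / 2^n)
        = 5/2 * (n * ((2^20)^u * (5/4 * (17/16)^2 / 2)^n)) := by
      rw [← f0, div_pow _ (2:ℝ) n, mul_pow (5/4:ℝ) _ n, pow_right_comm (17/16:ℝ) 2 n, pow_succ (5/4:ℝ) n,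
        pow_succ (2:ℝ) (2*(2*u)), mul_pow ((16:ℝ)^(2*u)) _ 2]
      ring
    rw [f2]
    calc 5/2 * (n * ((2^20)^u * (5/4 * (17/16)^2 / 2)^n))
        ≤ 5/2 * (n * ((6/5)^n * (5/4 * (17/16)^2 / 2 : ℝ)^n)) := by gcongr
      _ = 5/2 * (((n:ℝ)^2 * (6/5 * (5/4 * (17/16)^2 / 2))^n) * (1/n)) := by
          rw [← mul_pow]; field_simp
      _ ≤ 5/2 * (C0 * sd n) := by
          have := hC0' n
          have h2 := sd_ge hn1
          gcongr
      _ = _ := by ring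
  have e4 : (4/5 + (5/4)/√(u:ℝ)) * pot n ≤ 0.9 * pot n := by
    apply mul_le_mul_of_nonneg_right _ hpot
    linarith
  linarith

lemma pot_bound : ∃ K : ℝ, ∀ n : ℕ, 1 ≤ n → pot n ≤ K * sd n := by
  obtain ⟨N0, hN0, C, hC, h⟩ := recur
  have hs := sd_pos (n := N0) (by omega)
  set K := max (20 * C) ((5/4)^N0 / sd N0) with hK
  have hK1 : 20 * C ≤ K := le_max_left _ _
  have hK2 : (5/4)^N0 ≤ K * sd N0 := by
    rw [← div_le_iff₀ hs]; exact le_max_right _ _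
  have hK0 : 0 ≤ K := le_trans (by positivity) hK1
  have small : ∀ n, 1 ≤ n → n ≤ N0 → pot n ≤ K * sd n := by
    intro n hn hnN
    calc pot n ≤ (5/4)^n := pot_le n
      _ ≤ (5/4)^N0 := pow_le_pow_right₀ (by norm_num) hnN
      _ ≤ K * sd N0 := hK2
      _ ≤ K * sd n := by
        have := sd_anti hn hnN
        gcongr
  refine ⟨K, ?_⟩
  have big : ∀ n, N0 ≤ n → pot n ≤ K * sd n := by
    intro n hn
    induction n, hn using Nat.le_induction with
    | base => exact small N0 (by omega) le_rfl
    | succ n hn ih =>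
      have h1 := h n hn
      have h2 := sd_step n (by omega)
      have h3 := mul_le_mul_of_nonneg_left h2 hK0
      have h4 := mul_le_mul_of_nonneg_right hK1 (sd_pos (n := n) (by omega)).le
      linarith
  intro n hn
  rcases le_total n N0 with h1 | h1
  · exact small n hn h1
  · exact big n h1

lemma sd_eq (n : ℕ) : sd n = (n:ℝ)^(-(1/4:ℝ)) := by
  unfold sd
  rw [Real.sqrt_eq_rpow, Real.sqrt_eq_rpow, one_div, ← Real.rpow_neg (by positivity), ← Real.rpow_mul (by positivity)]
  norm_num

lemma main_bound (δ : ℝ) (hδ : 0 < δ) : ∃ C : ℝ, ∀ n : ℕ, 1 ≤ n →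
      unifProb (fun ω : UpIdx n → Bool => (bmat n ω).det = 0)
        ≤ C * (n : ℝ) ^ (-(1 / 8 : ℝ) + δ) := by
  obtain ⟨K, hK⟩ := pot_bound
  refine ⟨max K 0, ?_⟩
  intro n hn
  have h1 : (1:ℝ) ≤ n := by exact_mod_cast hn
  refine (prob_le_pot n).trans ((hK n hn).trans ?_)
  rw [sd_eq]
  gcongr
  · exact le_max_left _ _
  · linarith

lemma prob_compl (n : ℕ) : unifProb (fun ω : UpIdx n → Bool => (bmat n ω).det ≠ 0) =
    1 - unifProb (fun ω : UpIdx n → Bool => (bmat n ω).det = 0) := by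
  unfold unifProb
  have hpos : (0:ℝ) < (Fintype.card (UpIdx n → Bool) : ℝ) := by exact_mod_cast Fintype.card_pos
  have h4 := Finset.card_filter_add_card_filter_not (s := (Finset.univ : Finset (UpIdx n → Bool)))
    (fun ω => (bmat n ω).det = 0)
  rw [Finset.card_univ] at h4
  rw [eq_sub_iff_add_eq, ← add_div, div_eq_one_iff_eq hpos.ne', add_comm]
  exact_mod_cast h4

/-- Random symmetric Bernoulli matrices are almost surely non-singular: the singularity
probability is `O(n^{-1/8+δ})` for any fixed `δ > 0`; in particular the probability of
being non-singular tends to `1`. -/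
theorem random_symmetric_matrix_singular_prob (δ : ℝ) (hδ : 0 < δ) :
    (∃ C : ℝ, ∀ n : ℕ, 1 ≤ n →
      unifProb (fun ω : UpIdx n → Bool => (bmat n ω).det = 0)
        ≤ C * (n : ℝ) ^ (-(1 / 8 : ℝ) + δ)) ∧
    Filter.Tendsto
      (fun n : ℕ => unifProb (fun ω : UpIdx n → Bool => (bmat n ω).det ≠ 0))
      Filter.atTop (nhds 1) := by
  refine ⟨main_bound δ hδ, ?_⟩
  obtain ⟨C, hC⟩ := main_bound (1/16) (by norm_num)
  have h0 : Filter.Tendsto (fun n : ℕ => unifProb (fun ω : UpIdx n → Bool => (bmat n ω).det = 0))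
      Filter.atTop (nhds 0) := by
    have h1 : Filter.Tendsto (fun n : ℕ => C * (n:ℝ)^(-(1/16:ℝ))) Filter.atTop (nhds 0) := by
      have := (tendsto_rpow_neg_atTop (show (0:ℝ) < 1/16 by norm_num)).comp tendsto_natCast_atTop_atTop
      simpa using this.const_mul C
    refine tendsto_of_tendsto_of_tendsto_of_le_of_le' tendsto_const_nhds h1 ?_ ?_
    · filter_upwards with n
      unfold unifProb
      positivity
    · filter_upwards [Filter.eventually_ge_atTop 1] with n hn
      have := hC n hn
      norm_num at this ⊢
      exact this
  simp only [prob_compl]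
  simpa using h0.const_sub 1
end

section
/- Fix ε > 0 and set N = n^{1-ε}. Let (Q_n)_{n≥1} be a sequence of random symmetric matrices where Q_n is n×n with entries in {0,1}, all upper-diagonal entries q_{ij} (1 ≤ i ≤ j) over all n are i.i.d. uniform on {0,1}, and Q_{n+1} is obtained from Q_n by appending a new independent random {0,1}-column of length n+1 and its transpose as a new row. Define X_n = 0 if Q_n is nonsingular, and X_n = (1.1)^{n − rank(Q_n)} if Q_n is singular. Then for all sufficiently large n, E(X_{n+1}) ≤ 0.99 · E(X_n) + O(N^{-1/8}), with implied constant depending only on ε. -/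
open scoped Classical

/-- The expectation of a real random variable under the uniform measure on a finite type. -/
noncomputable def unifExp {α : Type*} [Fintype α] (f : α → ℝ) : ℝ :=
  (∑ a, f a) / (Fintype.card α : ℝ)

/-- `X_n = 0` if `Q_n` is nonsingular, and `X_n = (1.1)^(n - rank Q_n)` otherwise. -/
noncomputable def Xval {n : ℕ} (M : Matrix (Fin n) (Fin n) ℝ) : ℝ :=
  if M.det ≠ 0 then 0 else (1.1 : ℝ) ^ (n - M.rank)

namespace CTV
open Finset

noncomputable def bv {ι : Type*} (x : ι → Bool) (i : ι) : ℝ := if x i then 1 else 0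

lemma bv_inj {ι : Type*} {x y : ι → Bool} {i : ι} (h : bv x i = bv y i) : x i = y i := by
  unfold bv at h
  cases hx : x i <;> cases hy : y i <;> simp_all

lemma cb_bound (k : ℕ) : (k.centralBinom) ^ 2 * (2 * k + 1) ≤ 16 ^ k := by
  induction k with
  | zero => simp
  | succ k ih =>
    have h := Nat.succ_mul_centralBinom_succ k
    have h2 : ((k+1) * (k+1).centralBinom)^2 * (2 * k + 3) ≤ (k+1)^2 * 16^(k+1) := by
      rw [h]
      calc (2 * (2 * k + 1) * k.centralBinom) ^ 2 * (2 * k + 3)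
          = (k.centralBinom ^ 2 * (2 * k + 1)) * (4 * (2 * k + 1) * (2 * k + 3)) := by ring
        _ ≤ 16 ^ k * (16 * (k+1)^2) := by
          apply Nat.mul_le_mul ih
          nlinarith
        _ = _ := by ring
    have h3 : (k+1)^2 * ((k + 1).centralBinom ^ 2 * (2 * (k + 1) + 1)) ≤ (k+1)^2 * 16 ^ (k + 1) := by
      calc _ = ((k+1) * (k+1).centralBinom)^2 * (2 * k + 3) := by ring
        _ ≤ _ := h2
    exact Nat.le_of_mul_le_mul_left h3 (by positivity)

lemma cb_bound_real (k : ℕ) : (k.centralBinom : ℝ) * √(2 * k + 1) ≤ 2 ^ (2 * k) := by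
  have h : ((k.centralBinom : ℝ)) ^ 2 * (2 * k + 1) ≤ 16 ^ k := by exact_mod_cast cb_bound k
  apply abs_le_of_sq_le_sq' _ (by positivity) |>.2
  rw [mul_pow, Real.sq_sqrt (by positivity)]
  calc _ ≤ (16 : ℝ) ^ k := h
    _ = _ := by rw [← pow_mul, mul_comm (2*k) 2, ← mul_assoc, pow_mul]; norm_num

lemma LO_full {ι : Type*} [Fintype ι] [DecidableEq ι] (a : ι → ℝ) (ha : ∀ i, a i ≠ 0) (t : ℝ) :
    (univ.filter fun x : ι → Bool => ∑ i, a i * bv x i = t).card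
      ≤ (Fintype.card ι).choose (Fintype.card ι / 2) := by
  let φ : (ι → Bool) → Finset ι := fun x => univ.filter fun i => (x i = true ↔ 0 < a i)
  have hφ : Function.Injective φ := by
    intro x y h
    funext i
    have := Finset.ext_iff.1 h i
    simp only [φ, mem_filter, mem_univ, true_and] at this
    have h3 : ¬ (a i ≤ 0 ↔ 0 < a i) := by
      intro h4
      rcases le_or_gt (a i) 0 with h5 | h5
      · linarith [h4.1 h5]
      · linarith [h4.2 h5]
    have h3' : ¬ (0 < a i ↔ a i ≤ 0) := fun h => h3 h.symm
    cases hx : x i <;> cases hy : y i <;> simp_all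
  rw [← card_image_of_injective _ hφ]
  apply IsAntichain.sperner
  intro s hs s' hs' hne hle
  simp only [coe_image, Set.mem_image, mem_coe, mem_filter, mem_univ, true_and] at hs hs'
  obtain ⟨x, hx, rfl⟩ := hs
  obtain ⟨y, hy, rfl⟩ := hs'
  apply hne
  have key : ∀ i, 0 ≤ a i * bv y i - a i * bv x i ∧ (a i * bv y i - a i * bv x i = 0 → x i = y i) := by
    intro i
    have h1 : (x i = true ↔ 0 < a i) → (y i = true ↔ 0 < a i) := by
      have := @hle i
      simpa [φ] using this
    rcases lt_or_gt_of_ne (ha i) with h | h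
    · have h' : ¬ 0 < a i := by linarith
      unfold bv
      cases hx : x i <;> cases hy : y i <;> simp_all [le_of_lt]
    · unfold bv
      cases hx : x i <;> cases hy : y i <;> simp_all [le_of_lt]
  have hsum : ∑ i, (a i * bv y i - a i * bv x i) = 0 := by
    rw [sum_sub_distrib, hx, hy, sub_self]
  rw [sum_eq_zero_iff_of_nonneg (fun i _ => (key i).1)] at hsum
  have : x = y := funext fun i => (key i).2 (hsum i (mem_univ i))
  rw [this]

lemma LO {ι : Type*} [Fintype ι] [DecidableEq ι] (a : ι → ℝ) (t : ℝ) (k : ℕ)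
    (hk : 2 * k ≤ (univ.filter fun i => a i ≠ 0).card) :
    ((univ.filter fun x : ι → Bool => ∑ i, a i * bv x i = t).card : ℝ) * √(2 * k + 1)
      ≤ 2 ^ (Fintype.card ι) := by
  obtain ⟨S, hS, hSc⟩ := Finset.exists_subset_card_eq hk
  let e := Equiv.piEquivPiSubtypeProd (fun i => i ∈ S) (fun _ => Bool)
  have hcS : Fintype.card {i // i ∈ S} = 2 * k := by simp [hSc]
  have h1 : (univ.filter fun x : ι → Bool => ∑ i, a i * bv x i = t).card
      ≤ ∑ y : ({i // i ∉ S} → Bool), k.centralBinom := by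
    have : (univ.filter fun x : ι → Bool => ∑ i, a i * bv x i = t).card
      = ∑ y : ({i // i ∉ S} → Bool), (univ.filter fun x : {i // i ∈ S} → Bool =>
          ∑ i : {i // i ∈ S}, a i * bv x i = t - ∑ i : {i // i ∉ S}, a i * bv y i).card := by
      simp only [card_filter]
      rw [← Fintype.sum_prod_type_right']
      rw [← e.sum_comp]
      apply sum_congr rfl
      intro x _
      rw [← Fintype.sum_subtype_add_sum_subtype (fun i => i ∈ S)]
      congr 1
      simp only [e, Equiv.piEquivPiSubtypeProd, Equiv.coe_fn_mk, bv, eq_sub_iff_add_eq]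
      congr!
    rw [this]
    apply sum_le_sum
    intro y _
    have := LO_full (fun i : {i // i ∈ S} => a i) (fun i => by
      have := hS i.2
      simpa using this) (t - ∑ i : {i // i ∉ S}, a i * bv y i)
    rw [hcS] at this
    simpa [Nat.centralBinom] using this
  have hcard : Fintype.card {i // i ∉ S} + 2 * k = Fintype.card ι := by
    have := Fintype.card_subtype_compl (fun i => i ∈ S)
    have h3 : 2 * k ≤ Fintype.card ι := hSc ▸ Finset.card_le_univ S
    omega
  have h2 : ((univ.filter fun x : ι → Bool => ∑ i, a i * bv x i = t).card : ℝ)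
     ≤ 2 ^ (Fintype.card {i // i ∉ S}) * k.centralBinom := by
    refine (Nat.cast_le.2 h1).trans (le_of_eq ?_)
    simp
  calc _ ≤ 2 ^ (Fintype.card {i // i ∉ S}) * k.centralBinom * √(2 * k + 1) := by gcongr
    _ = 2 ^ (Fintype.card {i // i ∉ S}) * (k.centralBinom * √(2 * k + 1)) := by ring
    _ ≤ 2 ^ (Fintype.card {i // i ∉ S}) * 2 ^ (2 * k) := by gcongr; exact cb_bound_real k
    _ = _ := by rw [← pow_add, hcard]

lemma decouple {α β : Type*} [Fintype α] [Fintype β] [DecidableEq α] [DecidableEq β] (k : ℕ) (hk : 0 < k)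
    (hα : Fintype.card α = 4 * k) (C : α → β → ℝ)
    (hC : ∀ i, 2 * k ≤ (univ.filter fun j => C i j ≠ 0).card)
    (F : (α → Bool) → ℝ) (G : (β → Bool) → ℝ) (t : ℝ) :
    ((univ.filter fun p : (α → Bool) × (β → Bool) =>
      F p.1 + G p.2 + ∑ i, (∑ j, C i j * bv p.2 j) * bv p.1 i = t).card : ℝ) ^ 2 * √(2 * k + 1)
      ≤ 3 * (2 ^ (Fintype.card α + Fintype.card β)) ^ 2 := by
  set s := √(2 * (k:ℝ) + 1) with hs
  have hspos : 0 < s := by positivity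
  let E : (α → Bool) → (β → Bool) → Prop := fun x y =>
    F x + G y + ∑ i, (∑ j, C i j * bv y j) * bv x i = t
  let e : (α → Bool) → (β → Bool) → ℝ := fun x y => if E x y then 1 else 0
  let D : (β → Bool) → (β → Bool) → α → ℝ := fun y y' i => ∑ j, C i j * bv y j - ∑ j, C i j * bv y' j
  let Z : (β → Bool) → (β → Bool) → ℝ := fun y y' => ∑ i, if D y y' i = 0 then (1:ℝ) else 0
  have hcount : ((univ.filter fun p : (α → Bool) × (β → Bool) =>
      F p.1 + G p.2 + ∑ i, (∑ j, C i j * bv p.2 j) * bv p.1 i = t).card : ℝ)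
      = ∑ x, ∑ y, e x y := by
    rw [card_filter, Nat.cast_sum, Fintype.sum_prod_type]
    simp [e, E]
  have hCS : (∑ x, ∑ y, e x y) ^ 2 ≤ 2 ^ (Fintype.card α) * ∑ x, (∑ y, e x y) ^ 2 := by
    have := @sq_sum_le_card_mul_sum_sq (α → Bool) ℝ _ _ _ _ univ (fun x => ∑ y, e x y)
    simpa using this
  have hswap : ∑ x, (∑ y, e x y) ^ 2 = ∑ y, ∑ y', ∑ x, e x y * e x y' := by
    simp only [sq, sum_mul_sum]
    rw [sum_comm]
    apply sum_congr rfl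
    intro y _
    rw [sum_comm]
  -- pointwise bound
  have hpt : ∀ y y', (∑ x, e x y * e x y') * s ≤ 2 ^ (Fintype.card α) * (1 + s * (Z y y' / (2 * k))) := by
    intro y y'
    have hle : ∑ x, e x y * e x y' ≤ ((univ.filter fun x : α → Bool => ∑ i, D y y' i * bv x i = G y' - G y).card : ℝ) := by
      rw [card_filter, Nat.cast_sum]
      apply sum_le_sum
      intro x _
      simp only [e]
      by_cases h1 : E x y
      · by_cases h2 : E x y'
        · have : ∑ i, D y y' i * bv x i = G y' - G y := by
            simp only [D, sub_mul, sum_sub_distrib]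
            simp only [E] at h1 h2
            linarith
          simp [h1, h2, this]
        · simp only [h2, if_false, mul_zero]; positivity
      · simp only [h1, if_false, zero_mul]; positivity
    have hZ0 : 0 ≤ Z y y' := by
      apply sum_nonneg; intro i _; positivity
    by_cases hbig : 2 * k ≤ (univ.filter fun i => D y y' i ≠ 0).card
    · have := LO (D y y') (G y' - G y) k hbig
      calc _ ≤ _ := mul_le_mul_of_nonneg_right hle hspos.le
        _ ≤ 2 ^ (Fintype.card α) * 1 := by simpa using this
        _ ≤ _ := by gcongr; linarith [show 0 ≤ s * (Z y y' / (2 * k)) by positivity]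
    · have hZ : (2 * k : ℝ) ≤ Z y y' := by
        have h1 : Z y y' = (univ.filter fun i => D y y' i = 0).card := by
          simp [Z]
        have h2 := Finset.card_filter_add_card_filter_not (s := (univ : Finset α)) (fun i => D y y' i = 0)
        rw [card_univ, hα] at h2
        have h3 : 2 * k ≤ (univ.filter fun i => D y y' i = 0).card := by
          simp only [ne_eq] at hbig
          omega
        rw [h1]; exact_mod_cast h3
      have h4 : 1 ≤ Z y y' / (2 * k) := by
        rw [le_div_iff₀ (by positivity)]; linarith
      calc _ ≤ 2 ^ (Fintype.card α) * s := by
            gcongr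
            refine hle.trans ?_
            refine (Nat.cast_le.2 (card_filter_le _ _)).trans ?_
            simp
        _ ≤ 2 ^ (Fintype.card α) * (s * (Z y y' / (2 * k))) := by
            gcongr; nlinarith
        _ ≤ _ := by gcongr; linarith
  have hZsum : (∑ y, ∑ y', Z y y') * s ≤ 4 * k * (2 ^ (Fintype.card β)) ^ 2 := by
    have h1 : ∑ y, ∑ y', Z y y' = ∑ i, ∑ y', ((univ.filter fun y : β → Bool => ∑ j, C i j * bv y j = ∑ j, C i j * bv y' j).card : ℝ) := by
      simp only [Z]
      rw [sum_comm]
      have : ∀ y' : β → Bool, ∑ y, ∑ i, (if D y y' i = 0 then (1:ℝ) else 0) = ∑ i, ∑ y, (if D y y' i = 0 then (1:ℝ) else 0) := fun y' => sum_comm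
      simp only [this]
      rw [sum_comm]
      apply sum_congr rfl; intro i _
      apply sum_congr rfl; intro y' _
      rw [card_filter, Nat.cast_sum]
      simp [D, sub_eq_zero]
    rw [h1, sum_mul]
    calc _ ≤ ∑ i : α, ((2:ℝ) ^ (Fintype.card β)) ^ 2 := by
          apply sum_le_sum; intro i _
          rw [sum_mul]
          calc _ ≤ ∑ y' : β → Bool, (2:ℝ) ^ (Fintype.card β) := by
                apply sum_le_sum; intro y' _
                exact LO (C i) _ k (hC i)
            _ = _ := by simp [sq]
      _ = _ := by simp [hα]
  rw [hcount]
  have hfin : (∑ x, (∑ y, e x y) ^ 2) * s ≤ 2 ^ (Fintype.card α) * (3 * (2 ^ (Fintype.card β)) ^ 2) := by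
    rw [hswap, sum_mul]
    calc _ ≤ ∑ y, ∑ y', 2 ^ (Fintype.card α) * (1 + s * (Z y y' / (2 * k))) := by
          apply sum_le_sum; intro y _
          rw [sum_mul]
          apply sum_le_sum; intro y' _
          exact hpt y y'
      _ = 2 ^ (Fintype.card α) * ((2 ^ (Fintype.card β)) ^ 2 + ((∑ y, ∑ y', Z y y') * s) / (2 * k)) := by
          simp only [← mul_sum, sum_add_distrib, ← sum_div]
          simp
          ring
      _ ≤ 2 ^ (Fintype.card α) * ((2 ^ (Fintype.card β)) ^ 2 + (4 * k * (2 ^ (Fintype.card β)) ^ 2) / (2 * k)) := by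
          gcongr
      _ = _ := by field_simp; ring
  calc _ ≤ (2 ^ (Fintype.card α) * ∑ x, (∑ y, e x y) ^ 2) * s := by gcongr
    _ = 2 ^ (Fintype.card α) * ((∑ x, (∑ y, e x y) ^ 2) * s) := by ring
    _ ≤ 2 ^ (Fintype.card α) * (2 ^ (Fintype.card α) * (3 * (2 ^ (Fintype.card β)) ^ 2)) := by gcongr
    _ = _ := by rw [pow_add]; ring

lemma sum_split {ι : Type*} [Fintype ι] [DecidableEq ι] (J : Finset ι) (f : ι → ℝ) :
    ∑ i, f i = ∑ i : {i // i ∈ J}, f i + ∑ i : {i // i ∉ J}, f i := by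
  rw [← Fintype.sum_subtype_add_sum_subtype (fun i => i ∈ J)]
  congr!

lemma quad {ι : Type*} [Fintype ι] [DecidableEq ι] (C : Matrix ι ι ℝ) (hsym : ∀ i j, C i j = C j i)
    (k : ℕ) (hk : 0 < k) (hn : 4 * k ≤ Fintype.card ι)
    (hC : ∀ i, 6 * k ≤ (univ.filter fun j => C i j ≠ 0).card) (t : ℝ) :
    ((univ.filter fun x : ι → Bool => ∑ i, ∑ j, C i j * bv x j * bv x i = t).card : ℝ) ^ 2
      * √(2 * k + 1) ≤ 3 * (2 ^ (Fintype.card ι)) ^ 2 := by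
  obtain ⟨J, -, hJ⟩ := Finset.exists_subset_card_eq (s := (univ : Finset ι)) (n := 4 * k) (by simpa using hn)
  have hcard : Fintype.card {i // i ∈ J} + Fintype.card {i // i ∉ J} = Fintype.card ι := by
    have := Fintype.card_subtype_compl (fun i => i ∈ J)
    have h2 := Fintype.card_subtype_le (fun i => i ∈ J)
    omega
  have hrow : ∀ i : {i // i ∈ J}, 2 * k ≤
      (univ.filter fun j : {i // i ∉ J} => 2 * C i j ≠ 0).card := by
    intro i
    have h1 := hC i
    have h2 : (univ.filter fun j => C i j ≠ 0) ⊆ J ∪ ((univ.filter fun j : {i // i ∉ J} => 2 * C i j ≠ 0).map (Function.Embedding.subtype _)) := by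
      intro j hj
      by_cases h : j ∈ J
      · simp [h]
      · simp at hj
        simp [h, hj]
    have h3 := (card_le_card h2).trans (card_union_le _ _)
    rw [card_map] at h3
    omega
  have key := decouple (α := {i // i ∈ J}) (β := {i // i ∉ J}) k hk (by simp [hJ])
    (fun i j => 2 * C i j) hrow
    (fun x => ∑ i : {i // i ∈ J}, ∑ j : {i // i ∈ J}, C i j * bv x j * bv x i)
    (fun y => ∑ i : {i // i ∉ J}, ∑ j : {i // i ∉ J}, C i j * bv y j * bv y i) t
  rw [hcard] at key
  let e := Equiv.piEquivPiSubtypeProd (fun i => i ∈ J) (fun _ => Bool)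
  refine le_trans ?_ key
  gcongr
  apply card_le_card_of_injOn (fun x => e x)
  · intro x hx
    simp only [coe_filter, Set.mem_ofPred_eq, mem_univ, true_and] at hx ⊢
    rw [← hx]
    rw [sum_split J (fun i => ∑ j, C i j * bv x j * bv x i)]
    simp only [fun i => sum_split J (fun j => C i j * bv x j * bv x i), sum_add_distrib]
    have h1 : ∀ i : {i // i ∈ J}, bv (e x).1 i = bv x i := fun i => rfl
    have h2 : ∀ i : {i // i ∉ J}, bv (e x).2 i = bv x i := fun i => rfl
    have hcross : ∑ i : {i // i ∈ J}, (∑ j : {i // i ∉ J}, 2 * C i j * bv (e x).2 j) * bv (e x).1 i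
       = ∑ i : {i // i ∈ J}, ∑ j : {i // i ∉ J}, C i j * bv x j * bv x i
         + ∑ i : {i // i ∉ J}, ∑ j : {i // i ∈ J}, C i j * bv x j * bv x i := by
      rw [sum_comm (s := (univ : Finset {i // i ∉ J})), ← sum_add_distrib]
      apply sum_congr rfl; intro i _
      rw [sum_mul, ← sum_add_distrib]
      apply sum_congr rfl; intro j _
      rw [h1, h2, hsym j i]; ring
    rw [hcross]
    simp only [h1, h2]
    ring
  · intro x _ y _ h
    exact e.injective h

lemma mod2 {R S : Type*} [Fintype R] [Fintype S] [DecidableEq R] [DecidableEq S] (b : R → S → Bool) (c : S → ℝ)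
    (hc : c ≠ 0) (h : ∀ r, ∑ s, bv (b r) s * c s = 0) :
    ∃ d : S → ZMod 2, d ≠ 0 ∧ ∀ r, ∑ s, (if b r s then 1 else 0) * d s = 0 := by
  by_contra hcon
  push Not at hcon
  let BZ : Matrix R S ℤ := Matrix.of fun r s => if b r s then 1 else 0
  let B2 : Matrix R S (ZMod 2) := BZ.map (Int.castRingHom (ZMod 2))
  let BR : Matrix R S ℝ := BZ.map (Int.castRingHom ℝ)
  have hker : LinearMap.ker B2.mulVecLin = ⊥ := by
    rw [LinearMap.ker_eq_bot']
    intro d hd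
    by_contra hd0
    obtain ⟨r, hr⟩ := hcon d hd0
    apply hr
    have := congrFun hd r
    simpa [B2, BZ, Matrix.mulVec, dotProduct, apply_ite] using this
  obtain ⟨g, hg⟩ := LinearMap.exists_leftInverse_of_injective _ hker
  let L := LinearMap.toMatrix' g
  have hL : L * B2 = 1 := by
    have := congrArg LinearMap.toMatrix' hg
    rw [LinearMap.toMatrix'_comp] at this
    rw [show LinearMap.toMatrix' B2.mulVecLin = B2 from LinearMap.toMatrix'_toLin' B2] at this
    simpa [L] using this
  let LZ : Matrix S R ℤ := L.map (fun z => (z.val : ℤ))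
  have hLZ : LZ.map (Int.castRingHom (ZMod 2)) = L := by
    ext i j
    simp [LZ]
  have hdet : (LZ * BZ).det ≠ 0 := by
    intro h0
    have h1 := RingHom.map_det (Int.castRingHom (ZMod 2)) (LZ * BZ)
    rw [h0, RingHom.mapMatrix_apply, Matrix.map_mul, hLZ, hL] at h1
    simp at h1
  have hdetR : (LZ.map (Int.castRingHom ℝ) * BR).det ≠ 0 := by
    have h1 := RingHom.map_det (Int.castRingHom ℝ) (LZ * BZ)
    rw [RingHom.mapMatrix_apply, Matrix.map_mul] at h1
    rw [← h1]
    simpa using hdet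
  apply hc
  apply Matrix.eq_zero_of_mulVec_eq_zero hdetR
  rw [← Matrix.mulVec_mulVec]
  have : BR.mulVec c = 0 := by
    ext r
    simpa [BR, BZ, Matrix.mulVec, dotProduct, apply_ite, bv] using h r
  rw [this, Matrix.mulVec_zero]

end CTV

namespace CTV
open Finset

def upair {n : ℕ} (i j : Fin n) : UpIdx n := ⟨(min i j, max i j), min_le_max⟩

lemma bmat_apply {n : ℕ} (ω : UpIdx n → Bool) (i j : Fin n) :
    bmat n ω i j = bv (fun s => ω (upair i s)) j := rfl

lemma upair_comm {n : ℕ} (i j : Fin n) : upair i j = upair j i := by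
  simp [upair, min_comm, max_comm]

lemma bmat_symm {n : ℕ} (ω : UpIdx n → Bool) (i j : Fin n) : bmat n ω i j = bmat n ω j i := by
  rw [bmat_apply, bmat_apply]; simp only [bv, upair_comm]

lemma upair_eq {n : ℕ} {i j i' j' : Fin n} (h : upair i j = upair i' j') :
    (i = i' ∧ j = j') ∨ (i = j' ∧ j = i') := by
  simp only [upair, Subtype.mk.injEq, Prod.mk.injEq] at h
  obtain ⟨h1, h2⟩ := h
  rcases le_total i j with h | h <;> rcases le_total i' j' with h' | h' <;>
    simp only [h, h', min_eq_left, min_eq_right, max_eq_left, max_eq_right] at h1 h2 <;> simp [h1, h2]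

def Sparse {n : ℕ} (m : ℕ) (A : Matrix (Fin n) (Fin n) ℝ) : Prop :=
  ∃ c : Fin n → ℝ, c ≠ 0 ∧ (univ.filter fun i => c i ≠ 0).card ≤ m ∧
    ∃ j, ∀ i, i ≠ j → (A.mulVec c) i = 0

def Ev {n : ℕ} (S : Finset (Fin n)) (j : Fin n) (D : Finset (Fin n)) (ω : UpIdx n → Bool) : Prop :=
  ∀ i, i ∉ S → i ≠ j → ∑ s ∈ D, (if ω (upair i s) then (1 : ZMod 2) else 0) = 0

lemma sparse_ev {n m : ℕ} (hm : m ≤ n) (ω : UpIdx n → Bool) (h : Sparse m (bmat n ω)) :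
    ∃ S ∈ powersetCard m (univ : Finset (Fin n)), ∃ j, ∃ D ∈ S.powerset, D.Nonempty ∧ Ev S j D ω := by
  obtain ⟨c, hc0, hcm, j, hj⟩ := h
  obtain ⟨S, hS, hSm⟩ := Finset.exists_superset_card_eq hcm (by simpa using hm)
  have hcS : ∀ i, i ∉ S → c i = 0 := by
    intro i hi
    by_contra h
    exact hi (hS (by simpa using h))
  refine ⟨S, by simp [mem_powersetCard, hSm], j, ?_⟩
  obtain ⟨d, hd0, hd⟩ := mod2 (R := {i : Fin n // i ∉ S ∧ i ≠ j}) (S := {i // i ∈ S})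
    (fun r s => ω (upair r.1 s.1)) (fun s => c s) (by
      intro h0
      apply hc0
      funext i
      by_cases hi : i ∈ S
      · exact congrFun h0 ⟨i, hi⟩
      · exact hcS i hi) (by
      intro r
      have := hj r.1 r.2.2
      rw [Matrix.mulVec, dotProduct, sum_split S] at this
      rw [sum_eq_zero (s := (univ : Finset {i // i ∉ S})) (fun i _ => by rw [hcS i.1 i.2, mul_zero]), add_zero] at this
      exact this)
  refine ⟨(univ.filter fun s => d s ≠ 0).map (Function.Embedding.subtype _), ?_, ?_, ?_⟩
  · rw [mem_powerset]
    intro i hi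
    simp at hi
    exact hi.1
  · rw [map_nonempty]
    obtain ⟨s, hs⟩ := Function.ne_iff.1 hd0
    exact ⟨s, by simpa using hs⟩
  · intro i hi hij
    refine Eq.trans ?_ (hd ⟨i, hi, hij⟩)
    rw [sum_map, sum_filter]
    apply sum_congr rfl
    intro s _
    have : ∀ z : ZMod 2, z = 0 ∨ z = 1 := by decide
    rcases this (d s) with h | h
    · simp [h]
    · simp only [h, Function.Embedding.subtype_apply]
      split_ifs <;> simp_all

lemma ev_card {n m : ℕ} (S : Finset (Fin n)) (hS : S.card = m) (j : Fin n) (D : Finset (Fin n))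
    (hD : D ⊆ S) (hD0 : D.Nonempty) :
    (univ.filter fun ω : UpIdx n → Bool => Ev S j D ω).card * 2 ^ (n - m - 1)
      ≤ 2 ^ (Fintype.card (UpIdx n)) := by
  obtain ⟨s0, hs0⟩ := hD0
  let R : Finset (Fin n) := univ.filter fun i => i ∉ S ∧ i ≠ j
  have hR : n - m - 1 ≤ R.card := by
    have : (univ : Finset (Fin n)) ⊆ (S ∪ {j}) ∪ R := by
      intro i _
      by_cases h1 : i ∈ S <;> by_cases h2 : i = j <;> simp [h1, h2, R]
    have h1 := card_le_card this
    have h2 := card_union_le (S ∪ {j}) R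
    have h3 := card_union_le S {j}
    rw [card_univ, Fintype.card_fin] at h1
    rw [card_singleton] at h3
    omega
  let P : Finset (UpIdx n) := R.image (fun i => upair i s0)
  have hP : P.card = R.card := by
    apply card_image_of_injOn
    intro i hi i' hi' h
    simp only [R, coe_filter, mem_univ, true_and, Set.mem_ofPred_eq] at hi hi'
    rcases upair_eq h with h | h
    · exact h.1
    · exact absurd (h.1 ▸ hD hs0) hi.1
  have hinj : (univ.filter fun ω : UpIdx n → Bool => Ev S j D ω).card
      ≤ (univ : Finset ({p // p ∉ P} → Bool)).card := by
    apply card_le_card_of_injOn (fun ω p => ω p.1) (fun _ _ => by simp)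
    intro ω hω ω' hω' h
    simp only [coe_filter, mem_univ, true_and, Set.mem_ofPred_eq] at hω hω'
    have hoff : ∀ p, p ∉ P → ω p = ω' p := fun p hp => congrFun h ⟨p, hp⟩
    funext p
    by_cases hp : p ∈ P
    · obtain ⟨i, hi, rfl⟩ := mem_image.1 hp
      simp only [R, mem_filter, mem_univ, true_and] at hi
      have e1 := hω i hi.1 hi.2
      have e2 := hω' i hi.1 hi.2
      rw [← add_sum_erase _ _ hs0] at e1 e2
      have e3 : ∑ s ∈ D.erase s0, (if ω (upair i s) then (1 : ZMod 2) else 0)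
          = ∑ s ∈ D.erase s0, (if ω' (upair i s) then (1 : ZMod 2) else 0) := by
        apply sum_congr rfl
        intro s hs
        rw [hoff]
        intro hmem
        obtain ⟨i', hi', he⟩ := mem_image.1 hmem
        simp only [R, mem_filter, mem_univ, true_and] at hi'
        rcases upair_eq he with h | h
        · exact (mem_erase.1 hs).1 h.2.symm
        · exact hi'.1 (h.1 ▸ hD (mem_erase.1 hs).2)
      rw [e3] at e1
      have e4 := add_right_cancel (e1.trans e2.symm)
      cases h1 : ω (upair i s0) <;> cases h2 : ω' (upair i s0) <;> simp [h1, h2] at e4 ⊢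
    · exact hoff p hp
  have hc : Fintype.card {p // p ∉ P} + P.card = Fintype.card (UpIdx n) := by
    have := Fintype.card_subtype_compl (fun p => p ∈ P)
    have h3 := Finset.card_le_univ P
    have h4 : Fintype.card {p // p ∈ P} = P.card := by simp
    omega
  calc _ ≤ 2 ^ (Fintype.card {p // p ∉ P}) * 2 ^ P.card := by
        apply Nat.mul_le_mul
        · simpa using hinj
        · exact Nat.pow_le_pow_right (by norm_num) (hP ▸ hR)
    _ = _ := by rw [← pow_add, hc]

lemma sparse_card {n m : ℕ} (hm : m ≤ n) :
    (univ.filter fun ω : UpIdx n → Bool => Sparse m (bmat n ω)).card * 2 ^ (n - m - 1)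
      ≤ n ^ (m + 1) * 2 ^ m * 2 ^ (Fintype.card (UpIdx n)) := by
  have hsub : (univ.filter fun ω : UpIdx n → Bool => Sparse m (bmat n ω)) ⊆
      (powersetCard m (univ : Finset (Fin n))).biUnion fun S => (univ : Finset (Fin n)).biUnion fun j =>
        (S.powerset.filter fun D => D.Nonempty).biUnion fun D => univ.filter fun ω => Ev S j D ω := by
    intro ω hω
    simp only [mem_filter, mem_univ, true_and] at hω
    obtain ⟨S, hS, j, D, hD, hD0, hE⟩ := sparse_ev hm ω hω
    simp only [mem_biUnion]
    exact ⟨S, hS, j, mem_univ j, D, by simp [mem_filter, hD0]; simpa using hD, by simpa using hE⟩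
  calc _ ≤ (∑ S ∈ powersetCard m (univ : Finset (Fin n)), ∑ j : Fin n,
        ∑ D ∈ S.powerset.filter fun D => D.Nonempty, (univ.filter fun ω : UpIdx n → Bool => Ev S j D ω).card)
          * 2 ^ (n - m - 1) := by
        apply Nat.mul_le_mul_right
        refine (card_le_card hsub).trans ?_
        refine card_biUnion_le.trans (sum_le_sum fun S _ => ?_)
        refine card_biUnion_le.trans (sum_le_sum fun j _ => ?_)
        exact card_biUnion_le
    _ ≤ ∑ S ∈ powersetCard m (univ : Finset (Fin n)), ∑ j : Fin n,
        ∑ D ∈ S.powerset, 2 ^ (Fintype.card (UpIdx n)) := by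
        simp only [sum_mul]
        refine sum_le_sum fun S hS => sum_le_sum fun j _ => ?_
        refine le_trans (sum_le_sum fun D hD => ?_) (sum_le_sum_of_subset (filter_subset _ _))
        simp only [mem_filter, mem_powerset] at hD
        exact ev_card S (mem_powersetCard.1 hS).2 j D hD.1 hD.2
    _ = ∑ S ∈ powersetCard m (univ : Finset (Fin n)), n * (2 ^ m * 2 ^ (Fintype.card (UpIdx n))) := by
        refine sum_congr rfl fun S hS => ?_
        simp [(mem_powersetCard.1 hS).2]
    _ = n.choose m * (n * (2 ^ m * 2 ^ (Fintype.card (UpIdx n)))) := by simp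
    _ ≤ n ^ m * (n * (2 ^ m * 2 ^ (Fintype.card (UpIdx n)))) := Nat.mul_le_mul_right _ (Nat.choose_le_pow n m)
    _ = _ := by ring

/-! Linear algebra -/

lemma corank_eq {n : ℕ} (A : Matrix (Fin n) (Fin n) ℝ) :
    n - A.rank = Module.finrank ℝ (LinearMap.ker A.mulVecLin) := by
  have := LinearMap.finrank_range_add_finrank_ker A.mulVecLin
  rw [Module.finrank_fin_fun] at this
  unfold Matrix.rank
  omega

structure Ext {n : ℕ} (M : Matrix (Fin (n+1)) (Fin (n+1)) ℝ) (A : Matrix (Fin n) (Fin n) ℝ)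
    (x : Fin n → ℝ) (z : ℝ) : Prop where
  h11 : ∀ i j, M (Fin.castSucc i) (Fin.castSucc j) = A i j
  h12 : ∀ i, M (Fin.castSucc i) (Fin.last n) = x i
  h21 : ∀ i, M (Fin.last n) (Fin.castSucc i) = x i
  h22 : M (Fin.last n) (Fin.last n) = z

variable {n : ℕ} {M : Matrix (Fin (n+1)) (Fin (n+1)) ℝ} {A : Matrix (Fin n) (Fin n) ℝ}
    {x : Fin n → ℝ} {z : ℝ}

lemma Ext.ker (h : Ext M A x z) (u : Fin (n+1) → ℝ) (hu : M.mulVec u = 0) :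
    (∀ i, ∑ j, A i j * u (Fin.castSucc j) + x i * u (Fin.last n) = 0) ∧
    ∑ j, x j * u (Fin.castSucc j) + z * u (Fin.last n) = 0 := by
  constructor
  · intro i
    have := congrFun hu (Fin.castSucc i)
    simpa [Matrix.mulVec, dotProduct, Fin.sum_univ_castSucc, h.h11, h.h12] using this
  · have := congrFun hu (Fin.last n)
    simpa [Matrix.mulVec, dotProduct, Fin.sum_univ_castSucc, h.h21, h.h22] using this

lemma corank_good (h : Ext M A x z) (hA : ∀ i j, A i j = A j i) (v : Fin n → ℝ)
    (hv : A.mulVec v = 0) (hxv : ∑ i, v i * x i ≠ 0) :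
    (n + 1 - M.rank) + 1 ≤ n - A.rank := by
  rw [corank_eq, corank_eq]
  let ℓ : (Fin n → ℝ) →ₗ[ℝ] ℝ := ∑ i, x i • LinearMap.proj i
  have hℓ : ∀ w, ℓ w = ∑ i, x i * w i := by intro w; simp [ℓ]
  let π : (Fin (n+1) → ℝ) →ₗ[ℝ] (Fin n → ℝ) := LinearMap.funLeft ℝ ℝ Fin.castSucc
  have hlast : ∀ u, M.mulVec u = 0 → u (Fin.last n) = 0 := by
    intro u hu
    have h1 := (h.ker u hu).1
    have h2 : ∑ i, v i * (∑ j, A i j * u (Fin.castSucc j) + x i * u (Fin.last n)) = 0 :=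
      sum_eq_zero fun i _ => by rw [h1 i, mul_zero]
    simp only [mul_add, sum_add_distrib, mul_sum] at h2
    rw [sum_comm] at h2
    have h3 : ∑ j, ∑ i, v i * (A i j * u (Fin.castSucc j)) = 0 := by
      apply sum_eq_zero; intro j _
      have h4 := congrFun hv j
      simp only [Matrix.mulVec, dotProduct, Pi.zero_apply] at h4
      calc _ = (∑ i, A j i * v i) * u (Fin.castSucc j) := by
            rw [sum_mul]; apply sum_congr rfl; intro i _; rw [hA j i]; ring
        _ = 0 := by rw [h4, zero_mul]
    rw [h3, zero_add] at h2
    have h5 : (∑ i, v i * x i) * u (Fin.last n) = 0 := by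
      rw [sum_mul, ← h2]; apply sum_congr rfl; intro i _; ring
    exact (mul_eq_zero.1 h5).resolve_left hxv
  have hmap : ∀ u : LinearMap.ker M.mulVecLin, π u ∈ LinearMap.ker A.mulVecLin ⊓ LinearMap.ker ℓ := by
    rintro ⟨u, hu⟩
    have hu' : M.mulVec u = 0 := hu
    obtain ⟨h1, h2⟩ := h.ker u hu'
    have h0 := hlast u hu'
    simp only [h0, mul_zero, add_zero] at h1 h2
    constructor
    · show A.mulVec (π u) = 0
      funext i
      exact h1 i
    · show ℓ (π u) = 0
      rw [hℓ]; exact h2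
  let f : LinearMap.ker M.mulVecLin →ₗ[ℝ] ↥(LinearMap.ker A.mulVecLin ⊓ LinearMap.ker ℓ) :=
    (π ∘ₗ (LinearMap.ker M.mulVecLin).subtype).codRestrict _ hmap
  have hf : Function.Injective f := by
    rw [← LinearMap.ker_eq_bot, LinearMap.ker_eq_bot']
    rintro ⟨u, hu⟩ h0
    have hu' : M.mulVec u = 0 := hu
    have h1 : π u = 0 := congrArg Subtype.val h0
    ext i
    show u i = 0
    refine Fin.lastCases ?_ (fun i => ?_) i
    · exact hlast u hu'
    · exact congrFun h1 i
  have h1 := LinearMap.finrank_le_finrank_of_injective hf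
  have h2 : LinearMap.ker A.mulVecLin ⊓ LinearMap.ker ℓ < LinearMap.ker A.mulVecLin := by
    refine lt_of_le_of_ne inf_le_left ?_
    intro heq
    have h3 : v ∈ LinearMap.ker A.mulVecLin := hv
    rw [← heq] at h3
    have h4 : ℓ v = 0 := h3.2
    rw [hℓ] at h4
    apply hxv
    rw [← h4]; apply sum_congr rfl; intro i _; ring
  have h3 := Submodule.finrank_lt_finrank_of_lt h2
  omega

lemma corank_triv (h : Ext M A x z) : n + 1 - M.rank ≤ (n - A.rank) + 1 := by
  have h1 : M.submatrix Fin.castSucc Fin.castSucc = A := by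
    ext i j; exact h.h11 i j
  have h2 := Matrix.rank_submatrix_le M Fin.castSucc Fin.castSucc
  rw [h1] at h2
  omega

lemma nonsing (h : Ext M A x z) (hdet : A.det ≠ 0) (hM : M.det = 0) :
    ∑ i, ∑ j, A⁻¹ i j * x j * x i = z := by
  obtain ⟨u, hu0, hu⟩ := Matrix.exists_mulVec_eq_zero_iff.2 hM
  obtain ⟨h1, h2⟩ := h.ker u hu
  set w : Fin n → ℝ := fun j => u (Fin.castSucc j) with hw
  set c := u (Fin.last n) with hc
  have h3 : A.mulVec w = -(c • x) := by
    funext i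
    have := h1 i
    simp only [Matrix.mulVec, dotProduct, Pi.neg_apply, Pi.smul_apply, smul_eq_mul]
    linarith
  have hunit : IsUnit A.det := isUnit_iff_ne_zero.2 hdet
  have h4 : w = -(c • A⁻¹.mulVec x) := by
    have := congrArg (A⁻¹.mulVec) h3
    rw [Matrix.mulVec_mulVec, Matrix.nonsing_inv_mul _ hunit, Matrix.one_mulVec, Matrix.mulVec_neg,
      Matrix.mulVec_smul] at this
    exact this
  have hc0 : c ≠ 0 := by
    intro h0
    apply hu0
    rw [h0, zero_smul, neg_zero] at h4
    funext i
    refine Fin.lastCases ?_ (fun i => ?_) i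
    · exact h0
    · exact congrFun h4 i
  have h5 : ∑ j, x j * w j = -c * ∑ i, ∑ j, A⁻¹ i j * x j * x i := by
    rw [h4, mul_sum]
    apply sum_congr rfl; intro i _
    simp only [Matrix.mulVec, dotProduct, Pi.neg_apply, Pi.smul_apply, smul_eq_mul]
    rw [← sum_mul]; ring
  have h6 : ∑ j, x j * w j + z * c = 0 := h2
  rw [h5] at h6
  have : c * (z - ∑ i, ∑ j, A⁻¹ i j * x j * x i) = 0 := by linarith
  have := (mul_eq_zero.1 this).resolve_left hc0
  linarith

end CTV

namespace CTV
open Finset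

def restr {n : ℕ} (ω : UpIdx (n+1) → Bool) : (UpIdx n → Bool) × (Fin n → Bool) × Bool :=
  (fun p => ω (upair (Fin.castSucc p.1.1) (Fin.castSucc p.1.2)),
   fun i => ω (upair (Fin.castSucc i) (Fin.last n)), ω (upair (Fin.last n) (Fin.last n)))

lemma upair_self {n : ℕ} (p : UpIdx n) : upair p.1.1 p.1.2 = p := by
  apply Subtype.ext
  simp [upair, p.2]

lemma restr_bij (n : ℕ) : Function.Bijective (restr (n := n)) := by
  constructor
  · intro ω ω' h
    simp only [restr, Prod.mk.injEq] at h
    obtain ⟨h1, h2, h3⟩ := h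
    have key : ∀ i j : Fin (n+1), ω (upair i j) = ω' (upair i j) := by
      intro i j
      refine Fin.lastCases ?_ (fun i => ?_) i <;> refine Fin.lastCases ?_ (fun j => ?_) j
      · exact h3
      · rw [upair_comm]; exact congrFun h2 j
      · exact congrFun h2 i
      · rcases le_total i j with h | h
        · exact congrFun h1 ⟨(i, j), h⟩
        · rw [upair_comm]; exact congrFun h1 ⟨(j, i), h⟩
    funext p
    rw [← upair_self p]
    exact key _ _
  · rintro ⟨ω, x, z⟩
    let f : Fin (n+1) → Fin (n+1) → Bool := fun i j =>
      Fin.lastCases (motive := fun _ => Bool)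
        (Fin.lastCases (motive := fun _ => Bool) z x i)
        (fun j' => Fin.lastCases (motive := fun _ => Bool) z (fun i' => ω (upair i' j')) i) j
    refine ⟨fun p => f p.1.1 p.1.2, ?_⟩
    simp only [restr, Prod.mk.injEq]
    refine ⟨?_, ?_, ?_⟩
    · funext p
      have h1 : min (Fin.castSucc p.1.1) (Fin.castSucc p.1.2) = Fin.castSucc p.1.1 :=
        min_eq_left (by simpa using p.2)
      have h2 : max (Fin.castSucc p.1.1) (Fin.castSucc p.1.2) = Fin.castSucc p.1.2 :=
        max_eq_right (by simpa using p.2)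
      have h3 : (upair (Fin.castSucc p.1.1) (Fin.castSucc p.1.2)).1 = (Fin.castSucc p.1.1, Fin.castSucc p.1.2) := by
        simp only [upair, h1, h2]
      rw [h3]
      simp only [f, Fin.lastCases_castSucc, upair_self]
    · funext i
      have h1 : min (Fin.castSucc i) (Fin.last n) = Fin.castSucc i := min_eq_left (Fin.le_last _)
      have h2 : max (Fin.castSucc i) (Fin.last n) = Fin.last n := max_eq_right (Fin.le_last _)
      have h3 : (upair (Fin.castSucc i) (Fin.last n)).1 = (Fin.castSucc i, Fin.last n) := by
        simp only [upair, h1, h2]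
      rw [h3]
      simp only [f, Fin.lastCases_castSucc, Fin.lastCases_last]
    · have h3 : (upair (Fin.last n) (Fin.last n)).1 = (Fin.last n, Fin.last n) := by
        simp [upair]
      rw [h3]
      simp only [f, Fin.lastCases_last]

noncomputable def eqv (n : ℕ) := Equiv.ofBijective _ (restr_bij n)

noncomputable def bz (z : Bool) : ℝ := if z then 1 else 0

lemma ext_restr {n : ℕ} (ω : UpIdx (n+1) → Bool) :
    Ext (bmat (n+1) ω) (bmat n (restr ω).1) (bv (restr ω).2.1) (bz (restr ω).2.2) where
  h11 i j := by
    rw [bmat_apply, bmat_apply]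
    have : upair (Fin.castSucc (upair i j).1.1) (Fin.castSucc (upair i j).1.2) = upair (Fin.castSucc i) (Fin.castSucc j) := by
      rcases le_total i j with h | h
      · simp [upair, h]
      · rw [upair_comm i j, upair_comm (Fin.castSucc i)]
        simp [upair, h]
    show bv (fun s => ω s) (upair (Fin.castSucc i) (Fin.castSucc j)) =
      bv (fun s => ω s) (upair (Fin.castSucc (upair i j).1.1) (Fin.castSucc (upair i j).1.2))
    rw [this]
  h12 i := rfl
  h21 i := by rw [bmat_symm]; rfl
  h22 := rfl

lemma Xval_nonneg {n : ℕ} (M : Matrix (Fin n) (Fin n) ℝ) : 0 ≤ Xval M := by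
  unfold Xval; split_ifs <;> positivity

lemma Xval_le {n : ℕ} (M : Matrix (Fin n) (Fin n) ℝ) : Xval M ≤ (1.1 : ℝ) ^ (n - M.rank) := by
  unfold Xval; split_ifs <;> first | positivity | exact le_rfl

lemma per_sing {n : ℕ} (k : ℕ) (hk : 100 ≤ k) (hn : 6 * k ≤ n) (A : Matrix (Fin n) (Fin n) ℝ)
    (hA : ∀ i j, A i j = A j i) (hsp : ¬ Sparse (6 * k) A) (hdet : A.det = 0)
    (M : (Fin n → Bool) → Bool → Matrix (Fin (n+1)) (Fin (n+1)) ℝ)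
    (hM : ∀ x z, Ext (M x z) A (bv x) (bz z)) :
    ∑ x, ∑ z, Xval (M x z) ≤ 2 ^ (n + 1) * (0.99 * Xval A) := by
  obtain ⟨v, hv0, hv⟩ := Matrix.exists_mulVec_eq_zero_iff.2 hdet
  have hcard : 2 * k ≤ (univ.filter fun i => v i ≠ 0).card := by
    by_contra hlt
    exact hsp ⟨v, hv0, by omega, ⟨0, by omega⟩, fun i _ => congrFun hv i⟩
  have hLO := LO v 0 k hcard
  rw [Fintype.card_fin] at hLO
  set N := (univ.filter fun x : Fin n → Bool => ∑ i, v i * bv x i = 0).card with hN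
  have hs : (14 : ℝ) ≤ √(2 * k + 1) := by
    apply Real.le_sqrt_of_sq_le
    have : (100 : ℝ) ≤ k := by exact_mod_cast hk
    linarith
  have hN2 : (N : ℝ) * 14 ≤ 2 ^ n := le_trans (by gcongr) hLO
  have hXA : Xval A = (1.1 : ℝ) ^ (n - A.rank) := by simp [Xval, hdet]
  have hpt : ∀ x z, Xval (M x z) ≤ (Xval A) * (10 / 11 + if ∑ i, v i * bv x i = 0 then (1.1 : ℝ) else 0) := by
    intro x z
    refine (Xval_le _).trans ?_
    rw [hXA]
    split_ifs with h
    · calc (1.1 : ℝ) ^ (n + 1 - (M x z).rank) ≤ (1.1 : ℝ) ^ (n - A.rank + 1) :=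
            pow_le_pow_right₀ (by norm_num) (corank_triv (hM x z))
        _ = (1.1 : ℝ) ^ (n - A.rank) * 1.1 := pow_succ _ _
        _ ≤ _ := by gcongr; norm_num
    · have h1 := corank_good (hM x z) hA v hv h
      have h2 : (1.1 : ℝ) ^ (n + 1 - (M x z).rank) * 1.1 ≤ (1.1 : ℝ) ^ (n - A.rank) := by
        rw [← pow_succ]
        exact pow_le_pow_right₀ (by norm_num) h1
      rw [add_zero]
      linarith
  have hX0 := Xval_nonneg A
  calc ∑ x, ∑ z, Xval (M x z) ≤ ∑ x, ∑ z : Bool, (Xval A) * (10 / 11 + if ∑ i, v i * bv x i = 0 then (1.1 : ℝ) else 0) :=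
        sum_le_sum fun x _ => sum_le_sum fun z _ => hpt x z
    _ = 2 * Xval A * (2 ^ n * (10 / 11) + N * 1.1) := by
        simp only [sum_const, card_univ, Fintype.card_bool, nsmul_eq_mul, ← mul_sum, sum_add_distrib,
          ← sum_filter]
        simp [hN]
        ring
    _ ≤ 2 * Xval A * (2 ^ n * 0.99) := by gcongr; linarith
    _ = _ := by rw [pow_succ]; ring

lemma per_nonsing {n : ℕ} (k : ℕ) (hk : 100 ≤ k) (hn : 6 * k ≤ n) (A : Matrix (Fin n) (Fin n) ℝ)
    (hA : ∀ i j, A i j = A j i) (hsp : ¬ Sparse (6 * k) A) (hdet : A.det ≠ 0)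
    (M : (Fin n → Bool) → Bool → Matrix (Fin (n+1)) (Fin (n+1)) ℝ)
    (hM : ∀ x z, Ext (M x z) A (bv x) (bz z)) :
    ∑ x, ∑ z, Xval (M x z) ≤ 2 ^ (n + 1) * (1.1 * √(3 / √(2 * k + 1))) := by
  have hunit : IsUnit A.det := isUnit_iff_ne_zero.2 hdet
  have hAT : A.transpose = A := by ext i j; exact hA j i
  have hsymm : ∀ i j, A⁻¹ i j = A⁻¹ j i := by
    intro i j
    have := Matrix.transpose_nonsing_inv A
    rw [hAT] at this
    exact (congrFun (congrFun this j) i).trans rfl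
  have hrow : ∀ i, 6 * k ≤ (univ.filter fun j => A⁻¹ i j ≠ 0).card := by
    intro i
    by_contra hlt
    have hmul : A.mulVec (fun j => A⁻¹ i j) = Pi.single i 1 := by
      have h1 : (fun j => A⁻¹ i j) = A⁻¹.mulVec (Pi.single i 1) := by
        funext j; rw [Matrix.mulVec_single_one]; exact hsymm i j
      rw [h1, Matrix.mulVec_mulVec, Matrix.mul_nonsing_inv _ hunit, Matrix.one_mulVec]
    refine hsp ⟨fun j => A⁻¹ i j, ?_, (not_le.1 hlt).le, i, ?_⟩
    · intro h0
      rw [h0, Matrix.mulVec_zero] at hmul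
      have := congrFun hmul i
      simp at this
    · intro i' hi'
      rw [hmul]; simp [hi']
  have hq : ∀ t : ℝ, ((univ.filter fun x : Fin n → Bool => ∑ i, ∑ j, A⁻¹ i j * bv x j * bv x i = t).card : ℝ)
      ≤ 2 ^ n * √(3 / √(2 * k + 1)) := by
    intro t
    have h1 := quad A⁻¹ hsymm k (by omega) (by rw [Fintype.card_fin]; omega) hrow t
    rw [Fintype.card_fin] at h1
    refine (abs_le_of_sq_le_sq' ?_ (by positivity)).2
    rw [mul_pow, Real.sq_sqrt (by positivity)]
    have hs : 0 < √(2 * (k:ℝ) + 1) := by positivity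
    rw [mul_div_assoc', le_div_iff₀ hs]
    linarith
  have hr : n - A.rank = 0 := by
    rw [Matrix.rank_of_isUnit A ((Matrix.isUnit_iff_isUnit_det A).2 hunit)]
    simp
  have hpt : ∀ x z, Xval (M x z) ≤ 1.1 * (if ∑ i, ∑ j, A⁻¹ i j * bv x j * bv x i = bz z then (1:ℝ) else 0) := by
    intro x z
    by_cases hd : (M x z).det = 0
    · rw [if_pos (nonsing (hM x z) hdet hd)]
      refine (Xval_le _).trans ?_
      have := corank_triv (hM x z)
      rw [hr] at this
      calc _ ≤ (1.1 : ℝ) ^ 1 := pow_le_pow_right₀ (by norm_num) this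
        _ = _ := by norm_num
    · have : Xval (M x z) = 0 := by simp [Xval, hd]
      rw [this]; positivity
  calc ∑ x, ∑ z, Xval (M x z) ≤ ∑ x, ∑ z, 1.1 * (if ∑ i, ∑ j, A⁻¹ i j * bv x j * bv x i = bz z then (1:ℝ) else 0) :=
        sum_le_sum fun x _ => sum_le_sum fun z _ => hpt x z
    _ = 1.1 * ∑ z, ((univ.filter fun x : Fin n → Bool => ∑ i, ∑ j, A⁻¹ i j * bv x j * bv x i = bz z).card : ℝ) := by
        rw [sum_comm]
        simp only [← mul_sum]
        simp
    _ ≤ 1.1 * ∑ z : Bool, 2 ^ n * √(3 / √(2 * k + 1)) := by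
        gcongr with z _
        exact hq _
    _ = _ := by simp; ring

lemma sum_restr {n : ℕ} (f : (UpIdx (n+1) → Bool) → ℝ) :
    ∑ ω, f ω = ∑ ω' : UpIdx n → Bool, ∑ x : Fin n → Bool, ∑ z : Bool, f ((eqv n).symm (ω', x, z)) := by
  rw [← (eqv n).symm.sum_comp, Fintype.sum_prod_type]
  simp only [Fintype.sum_prod_type]

lemma ext_eqv {n : ℕ} (ω' : UpIdx n → Bool) (x : Fin n → Bool) (z : Bool) :
    Ext (bmat (n+1) ((eqv n).symm (ω', x, z))) (bmat n ω') (bv x) (bz z) := by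
  have h := ext_restr ((eqv n).symm (ω', x, z))
  have h2 : restr ((eqv n).symm (ω', x, z)) = (ω', x, z) := (eqv n).apply_symm_apply _
  rw [h2] at h
  exact h

lemma main_bound {n : ℕ} (k : ℕ) (hk : 100 ≤ k) (hn : 6 * k ≤ n) :
    unifExp (fun ω : UpIdx (n + 1) → Bool => Xval (bmat (n + 1) ω))
        ≤ (0.99 : ℝ) * unifExp (fun ω : UpIdx (n + 1) → Bool =>
              Xval ((bmat (n + 1) ω).submatrix Fin.castSucc Fin.castSucc))
          + (1.1 * √(3 / √(2 * k + 1)) + 1.1 ^ (n + 1) * ((n : ℝ) ^ (6 * k + 1) * 2 ^ (6 * k) / 2 ^ (n - 6 * k - 1))) := by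
  set η := 1.1 * √(3 / √(2 * (k:ℝ) + 1)) with hη
  set q := ((n : ℝ) ^ (6 * k + 1) * 2 ^ (6 * k) / 2 ^ (n - 6 * k - 1)) with hq
  set T : ℝ := (Fintype.card (UpIdx n → Bool) : ℝ) with hT
  have hT0 : 0 < T := by rw [hT]; exact_mod_cast Fintype.card_pos
  have hcard : (Fintype.card (UpIdx (n+1) → Bool) : ℝ) = T * 2 ^ (n + 1) := by
    rw [Fintype.card_congr (eqv n), Fintype.card_prod, Fintype.card_prod]
    rw [show Fintype.card (Fin n → Bool) = 2 ^ n by simp, Fintype.card_bool]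
    push_cast
    rw [← hT]
    ring
  have hper : ∀ ω' : UpIdx n → Bool, ∑ x : Fin n → Bool, ∑ z : Bool, Xval (bmat (n+1) ((eqv n).symm (ω', x, z)))
      ≤ 2 ^ (n+1) * (0.99 * Xval (bmat n ω') + η + 1.1 ^ (n+1) * if Sparse (6 * k) (bmat n ω') then 1 else 0) := by
    intro ω'
    have hX0 := Xval_nonneg (bmat n ω')
    have hη0 : 0 ≤ η := by positivity
    by_cases hsp : Sparse (6 * k) (bmat n ω')
    · rw [if_pos hsp]
      calc _ ≤ ∑ x : Fin n → Bool, ∑ z : Bool, (1.1 : ℝ) ^ (n+1) := by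
            refine sum_le_sum fun x _ => sum_le_sum fun z _ => (Xval_le _).trans ?_
            exact pow_le_pow_right₀ (by norm_num) (Nat.sub_le _ _)
        _ = 2 ^ (n+1) * (1.1 : ℝ) ^ (n+1) := by
            simp only [sum_const, card_univ, Fintype.card_bool, nsmul_eq_mul, Fintype.card_fun, Fintype.card_fin]
            push_cast
            ring
        _ ≤ _ := by gcongr; linarith
    · rw [if_neg hsp]
      by_cases hd : (bmat n ω').det = 0
      · refine (per_sing k hk hn _ (bmat_symm ω') hsp hd _ (ext_eqv ω')).trans ?_
        gcongr; linarith
      · refine (per_nonsing k hk hn _ (bmat_symm ω') hsp hd _ (ext_eqv ω')).trans ?_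
        gcongr; linarith
  have hspc : (∑ ω' : UpIdx n → Bool, if Sparse (6 * k) (bmat n ω') then (1:ℝ) else 0) ≤ T * q := by
    have h1 := sparse_card (n := n) (m := 6 * k) hn
    have h2 : ((univ.filter fun ω : UpIdx n → Bool => Sparse (6 * k) (bmat n ω)).card : ℝ) * 2 ^ (n - 6 * k - 1)
      ≤ (n : ℝ) ^ (6 * k + 1) * 2 ^ (6 * k) * 2 ^ (Fintype.card (UpIdx n)) := by exact_mod_cast h1
    have h3 : T = 2 ^ (Fintype.card (UpIdx n)) := by rw [hT]; simp
    rw [sum_boole, hq, h3, mul_div_assoc', le_div_iff₀ (by positivity)]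
    linarith
  have hsub : ∑ ω : UpIdx (n + 1) → Bool, Xval ((bmat (n + 1) ω).submatrix Fin.castSucc Fin.castSucc)
      = 2 ^ (n+1) * ∑ ω', Xval (bmat n ω') := by
    rw [sum_restr, mul_sum]
    apply sum_congr rfl; intro ω' _
    have : ∀ x z, (bmat (n+1) ((eqv n).symm (ω', x, z))).submatrix Fin.castSucc Fin.castSucc = bmat n ω' := by
      intro x z; ext i j; exact (ext_eqv ω' x z).h11 i j
    simp only [this, sum_const, card_univ, Fintype.card_bool, nsmul_eq_mul, Fintype.card_fun, Fintype.card_fin]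
    push_cast
    ring
  unfold unifExp
  rw [hsub, hcard, div_le_iff₀ (by positivity), sum_restr]
  calc _ ≤ ∑ ω' : UpIdx n → Bool, 2 ^ (n+1) * (0.99 * Xval (bmat n ω') + η + 1.1 ^ (n+1) * if Sparse (6 * k) (bmat n ω') then 1 else 0) :=
        sum_le_sum fun ω' _ => hper ω'
    _ = 2 ^ (n+1) * (0.99 * ∑ ω', Xval (bmat n ω') + T * η + 1.1 ^ (n+1) * ∑ ω' : UpIdx n → Bool, if Sparse (6 * k) (bmat n ω') then (1:ℝ) else 0) := by
        simp only [← mul_sum, sum_add_distrib, sum_const, card_univ, nsmul_eq_mul, ← hT]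
    _ ≤ 2 ^ (n+1) * (0.99 * ∑ ω', Xval (bmat n ω') + T * η + 1.1 ^ (n+1) * (T * q)) := by gcongr
    _ = _ := by field_simp; ring

open Filter Asymptotics in
lemma asym : ∀ᶠ n : ℕ in atTop, (1.1:ℝ) ^ (n + 1) * ((n : ℝ) ^ (6 * n.sqrt + 1) * 2 ^ (6 * n.sqrt) / 2 ^ (n - 6 * n.sqrt - 1))
    ≤ (n : ℝ) ^ (-(1/8 : ℝ)) := by
  set c : ℝ := Real.log (2 / 1.1) / 20 with hc
  have hc0 : 0 < c := by
    have : 0 < Real.log (2 / 1.1) := Real.log_pos (by norm_num)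
    positivity
  have h1 : ∀ᶠ y : ℝ in atTop, ‖Real.log y‖ ≤ c * ‖y ^ (1/2 : ℝ)‖ :=
    (isLittleO_log_rpow_atTop (by norm_num : (0:ℝ) < 1/2)).bound hc0
  have h2 := tendsto_natCast_atTop_atTop (R := ℝ) |>.eventually h1
  filter_upwards [h2, eventually_ge_atTop 10000] with n hlog hn
  set k := n.sqrt with hk
  have hk2 : k * k ≤ n := Nat.sqrt_le n
  have hk100 : 100 ≤ k := by rw [hk]; exact Nat.le_sqrt.2 (by omega)
  have h12 : 12 * k + 1 ≤ n := by nlinarith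
  have hnR : (10000 : ℝ) ≤ n := by exact_mod_cast hn
  have hn0 : (0:ℝ) < n := by linarith
  have hlog0 : 0 ≤ Real.log n := Real.log_nonneg (by linarith)
  rw [Real.norm_of_nonneg hlog0, Real.norm_of_nonneg (by positivity), ← Real.sqrt_eq_rpow] at hlog
  have hks : (k : ℝ) ≤ √n := by
    apply Real.le_sqrt_of_sq_le
    rw [sq]; exact_mod_cast hk2
  have hmain : (1.1 : ℝ) ^ n * (n : ℝ) ^ (12 * k + 3) ≤ 2 ^ n := by
    rw [← Real.log_le_log_iff (by positivity) (by positivity), Real.log_mul (by positivity) (by positivity),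
      Real.log_pow, Real.log_pow, Real.log_pow]
    have e1 : Real.log (2 / 1.1) = Real.log 2 - Real.log 1.1 := Real.log_div (by norm_num) (by norm_num)
    have e2 : ((12 * k + 3 : ℕ) : ℝ) ≤ 20 * √n := by
      push_cast
      have : (100:ℝ) ≤ k := by exact_mod_cast hk100
      linarith
    have e3 : ((12 * k + 3 : ℕ) : ℝ) * Real.log n ≤ n * Real.log (2 / 1.1) := by
      calc _ ≤ (20 * √n) * (c * √n) := by gcongr
        _ = 20 * c * (√n * √n) := by ring
        _ = n * Real.log (2 / 1.1) := by rw [Real.mul_self_sqrt hn0.le, hc]; ring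
    rw [e1] at e3
    linarith
  have hpow : (n : ℝ) ^ (1/8 : ℝ) ≤ n := by
    calc _ ≤ (n : ℝ) ^ (1 : ℝ) := Real.rpow_le_rpow_of_exponent_le (by linarith) (by norm_num)
      _ = n := Real.rpow_one _
  have hsplit : (2 : ℝ) ^ n = 2 ^ (n - 6 * k - 1) * 2 ^ (6 * k + 1) := by
    rw [← pow_add]; congr 1; omega
  rw [Real.rpow_neg hn0.le, mul_div_assoc', div_le_iff₀ (by positivity), inv_mul_eq_div,
    le_div_iff₀ (by positivity)]
  have h4 : (2 : ℝ) ^ (6 * k) * 2 ^ (6 * k) ≤ (n : ℝ) ^ (6 * k) := by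
    rw [← mul_pow]; gcongr; linarith
  refine le_of_mul_le_mul_right ?_ (show (0:ℝ) < 2 ^ (6 * k + 1) by positivity)
  rw [← hsplit]
  refine le_trans ?_ hmain
  calc 1.1 ^ (n + 1) * ((n:ℝ) ^ (6 * k + 1) * 2 ^ (6 * k)) * (n:ℝ) ^ (1 / 8 : ℝ) * 2 ^ (6 * k + 1)
      = 1.1 ^ n * (n:ℝ) ^ (6 * k + 1) * (2 ^ (6 * k) * 2 ^ (6 * k)) * (n:ℝ) ^ (1 / 8 : ℝ) * 2.2 := by ring
    _ ≤ 1.1 ^ n * (n:ℝ) ^ (6 * k + 1) * (n : ℝ) ^ (6 * k) * n * n := by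
        gcongr; linarith
    _ = _ := by ring

lemma eta_bound (n : ℕ) (hn : 1 ≤ n) :
    1.1 * √(3 / √(2 * (n.sqrt : ℝ) + 1)) ≤ 3 * (n : ℝ) ^ (-(1/8 : ℝ)) := by
  have hn0 : (0:ℝ) < n := by exact_mod_cast hn
  have h1 : √(n:ℝ) ≤ 2 * (n.sqrt : ℝ) + 1 := by
    have : √(n:ℝ) ≤ (n.sqrt : ℝ) + 1 := by
      apply Real.sqrt_le_iff.2 ⟨by positivity, ?_⟩
      have := Nat.lt_succ_sqrt n
      rw [sq]
      exact_mod_cast this.le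
    have h0 : (0:ℝ) ≤ n.sqrt := by positivity
    linarith
  have h2 : √(√(n:ℝ)) ≤ √(2 * (n.sqrt : ℝ) + 1) := Real.sqrt_le_sqrt h1
  have h3 : √(3 / √(2 * (n.sqrt : ℝ) + 1)) ≤ √(3 / √(√(n:ℝ))) := by
    apply Real.sqrt_le_sqrt; gcongr
  have h4 : √(3 / √(√(n:ℝ))) = √3 * (n : ℝ) ^ (-(1/8 : ℝ)) := by
    rw [Real.sqrt_div (by norm_num), Real.rpow_neg hn0.le, div_eq_mul_inv]
    congr 2
    simp only [Real.sqrt_eq_rpow]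
    rw [← Real.rpow_mul hn0.le, ← Real.rpow_mul hn0.le]
    norm_num
  have h5 : √3 ≤ (2:ℝ) := by
    apply Real.sqrt_le_iff.2; norm_num
  rw [h4] at h3
  have h6 : 0 ≤ (n : ℝ) ^ (-(1/8 : ℝ)) := by positivity
  nlinarith

end CTV

/-- For the coupled sequence of random symmetric Bernoulli matrices (where `Q_n` is the
top-left `n × n` submatrix of `Q_{n+1}`), one has
`E(X_{n+1}) ≤ 0.99 E(X_n) + O(N^{-1/8})` with `N = n^{1-ε}` for all sufficiently large `n`,
the implied constant depending only on `ε`. -/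
theorem expectation_decay (ε : ℝ) (hε : 0 < ε) :
    ∃ C : ℝ, ∃ n₀ : ℕ, ∀ n : ℕ, n₀ ≤ n →
      unifExp (fun ω : UpIdx (n + 1) → Bool => Xval (bmat (n + 1) ω))
        ≤ (0.99 : ℝ) *
            unifExp (fun ω : UpIdx (n + 1) → Bool =>
              Xval ((bmat (n + 1) ω).submatrix Fin.castSucc Fin.castSucc))
          + C * ((n : ℝ) ^ (1 - ε)) ^ (-(1 / 8 : ℝ)) := by
  obtain ⟨n₁, hn₁⟩ := Filter.eventually_atTop.1 CTV.asym
  refine ⟨4, max n₁ 10000, fun n hn => ?_⟩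
  have hn1 : n₁ ≤ n := le_trans (le_max_left _ _) hn
  have hn2 : 10000 ≤ n := le_trans (le_max_right _ _) hn
  have hk100 : 100 ≤ n.sqrt := Nat.le_sqrt.2 (by omega)
  have hk2 : n.sqrt * n.sqrt ≤ n := Nat.sqrt_le n
  have hkn : 6 * n.sqrt ≤ n := by nlinarith
  have h1 := CTV.main_bound (n := n) n.sqrt hk100 hkn
  have h2 := hn₁ n hn1
  have h3 := CTV.eta_bound n (by omega)
  have hnR : (1 : ℝ) ≤ n := by exact_mod_cast (by omega : 1 ≤ n)
  have h4 : (n : ℝ) ^ (-(1/8 : ℝ)) ≤ ((n : ℝ) ^ (1 - ε)) ^ (-(1 / 8 : ℝ)) := by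
    rw [← Real.rpow_mul (by positivity)]
    apply Real.rpow_le_rpow_of_exponent_le hnR
    linarith
  linarith
end
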